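/- arXiv:2211.02190 — 2 statements merged into one kernel-verified Lean document; each statement's English description precedes it below -/
import Mathlib

section
/- If K ⊆ [0,1]ⁿ is a homogeneous compact set and f : ℝⁿ → ℝᵐ is linear, then f is dimension conserving for K; that is, there exists Δ ≥ 0 such that Δ + dim{ y ∈ f(K) : dim(K ∩ f⁻¹(y)) ≥ Δ } ≥ dim K. -/
open Set Metric MeasureTheory Module Filter Topology
open scoped ENNReal NNReal RealInnerProductSpace

noncomputable section

/-- The closed unit cube `[0,1]ⁿ ⊆ ℝⁿ`. -/
def unitCube (n : ℕ) : Set (EuclideanSpace ℝ (Fin n)) :=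
  {x | ∀ i, x i ∈ Set.Icc (0 : ℝ) 1}

/-- `K'` is a miniset of `K`: a nonempty closed subset of `[0,1]ⁿ` contained in the image
of `K` under an expanding homothety `x ↦ r x + b`, `|r| ≥ 1`. -/
def IsMiniset {n : ℕ} (K K' : Set (EuclideanSpace ℝ (Fin n))) : Prop :=
  IsClosed K' ∧ K'.Nonempty ∧ K' ⊆ unitCube n ∧
    ∃ (r : ℝ) (b : EuclideanSpace ℝ (Fin n)), 1 ≤ |r| ∧ K' ⊆ (fun x => r • x + b) '' K

/-- `K''` is a microset of `K`: a limit of minisets of `K` in the Hausdorff metric. -/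
def IsMicroset {n : ℕ} (K K'' : Set (EuclideanSpace ℝ (Fin n))) : Prop :=
  IsClosed K'' ∧ K''.Nonempty ∧ K'' ⊆ unitCube n ∧
    ∃ Ks : ℕ → Set (EuclideanSpace ℝ (Fin n)), (∀ i, IsMiniset K (Ks i)) ∧
      Filter.Tendsto (fun i => Metric.hausdorffDist (Ks i) K'') Filter.atTop (nhds 0)

/-- A set `K ⊆ [0,1]ⁿ` is homogeneous if every microset of `K` is a miniset of `K`. -/
def IsHomogeneous {n : ℕ} (K : Set (EuclideanSpace ℝ (Fin n))) : Prop :=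
  K ⊆ unitCube n ∧ ∀ K'', IsMicroset K K'' → IsMiniset K K''

set_option linter.unusedSectionVars false

section FiniteCore

lemma sum_biUnion_le' {α β : Type*} [DecidableEq β] (I : Finset α) (S : α → Finset β) (w : β → ℝ)
    (hw : ∀ x, 0 ≤ w x) : ∑ x ∈ I.biUnion S, w x ≤ ∑ i ∈ I, ∑ x ∈ S i, w x := by
  classical
  induction I using Finset.induction_on with
  | empty => simp
  | insert i I hi ih =>
    rw [Finset.biUnion_insert, Finset.sum_insert hi]
    have h := Finset.sum_union_inter (s₁ := S i) (s₂ := I.biUnion S) (f := w)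
    have h0 : 0 ≤ ∑ x ∈ S i ∩ I.biUnion S, w x := Finset.sum_nonneg fun x _ => hw x
    linarith

variable {U V A B : Type*} [DecidableEq U] [DecidableEq V] [DecidableEq A] [DecidableEq B]

/-- number of points of `T` over `u` -/
def fib (T : Finset (U × V)) (u : U) : ℝ := ((T.filter (fun p => p.1 = u)).card : ℝ)

/-- the `L^q` sum of the fibre counts -/
def Phi (q : ℝ) (T : Finset (U × V)) : ℝ := ∑ p ∈ T, fib T p.1 ^ (q - 1)

lemma fib_nonneg (T : Finset (U × V)) (u : U) : 0 ≤ fib T u := Nat.cast_nonneg _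

lemma one_le_fib {T : Finset (U × V)} {p : U × V} (hp : p ∈ T) : 1 ≤ fib T p.1 := by
  unfold fib
  exact_mod_cast Finset.card_pos.2 ⟨p, by simp [hp]⟩

lemma fib_eq_zero {T : Finset (U × V)} {u : U} (hu : u ∉ T.image Prod.fst) : fib T u = 0 := by
  unfold fib
  rw [Nat.cast_eq_zero, Finset.card_eq_zero, Finset.filter_eq_empty_iff]
  intro p hp h
  exact hu (Finset.mem_image.2 ⟨p, hp, h⟩)

lemma sum_fst (T : Finset (U × V)) (W : U → ℝ) :
    ∑ p ∈ T, W p.1 = ∑ u ∈ T.image Prod.fst, fib T u * W u := by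
  rw [Finset.sum_comp W Prod.fst]
  simp [fib, nsmul_eq_mul]

lemma mul_rpow_sub_one {x q : ℝ} (hx : 0 ≤ x) (hq : 1 ≤ q) : x * x ^ (q - 1) = x ^ q := by
  rcases hx.eq_or_lt with rfl | h
  · rw [zero_mul, Real.zero_rpow (by linarith)]
  · rw [Real.rpow_sub_one h.ne']; field_simp

lemma phi_image {q : ℝ} (hq : 1 ≤ q) (T : Finset (U × V)) :
    Phi q T = ∑ u ∈ T.image Prod.fst, fib T u ^ q := by
  unfold Phi
  rw [sum_fst T (fun u => fib T u ^ (q - 1))]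
  exact Finset.sum_congr rfl fun u _ => mul_rpow_sub_one (fib_nonneg _ _) hq

lemma sum_le_phi {q : ℝ} (hq : 1 ≤ q) (T : Finset (U × V)) (W : Finset U) :
    ∑ u ∈ W, fib T u ^ q ≤ Phi q T := by
  rw [phi_image hq]
  calc ∑ u ∈ W, fib T u ^ q = ∑ u ∈ W.filter (fun u => u ∈ T.image Prod.fst), fib T u ^ q := by
        rw [Finset.sum_filter]
        refine Finset.sum_congr rfl fun u _ => ?_
        split_ifs with h
        · rfl
        · rw [fib_eq_zero h, Real.zero_rpow (by linarith)]
    _ ≤ _ := by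
        refine Finset.sum_le_sum_of_subset_of_nonneg ?_ fun _ _ _ =>
          Real.rpow_nonneg (fib_nonneg _ _) _
        intro u hu
        exact (Finset.mem_filter.1 hu).2

lemma phi_nonneg (q : ℝ) (T : Finset (U × V)) : 0 ≤ Phi q T :=
  Finset.sum_nonneg fun _ _ => Real.rpow_nonneg (fib_nonneg _ _) _

lemma phi_one (T : Finset (U × V)) : Phi 1 T = T.card := by
  simp [Phi]

lemma phi_mono_exp {q q' : ℝ} (h : q ≤ q') (T : Finset (U × V)) : Phi q T ≤ Phi q' T :=
  Finset.sum_le_sum fun _ hp => Real.rpow_le_rpow_of_exponent_le (one_le_fib hp) (by linarith)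

lemma card_le_phi {q : ℝ} (hq : 1 ≤ q) (T : Finset (U × V)) : (T.card : ℝ) ≤ Phi q T := by
  rw [← phi_one]; exact phi_mono_exp hq T

/-- the points of `T` in the cell `C` -/
def cellPart (a : U → A) (b : V → B) (T : Finset (U × V)) (C : A × B) : Finset (U × V) :=
  T.filter (fun p => Prod.map a b p = C)

lemma fib_split (a : U → A) (b : V → B) (T : Finset (U × V)) (u : U) :
    fib T u = ∑ C ∈ (T.image (Prod.map a b)).filter (fun C => C.1 = a u),
      fib (cellPart a b T C) u := by
  unfold fib
  rw [← Nat.cast_sum, Nat.cast_inj]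
  rw [Finset.card_eq_sum_card_fiberwise (f := Prod.map a b)
    (t := (T.image (Prod.map a b)).filter (fun C => C.1 = a u))]
  · refine Finset.sum_congr rfl fun C _ => ?_
    congr 1
    ext p
    simp only [cellPart, Finset.mem_filter]
    tauto
  · intro p hp
    simp only [Finset.coe_filter, Set.mem_ofPred_eq] at hp
    simp only [Finset.coe_filter, Set.mem_ofPred_eq]
    refine ⟨Finset.mem_image_of_mem _ hp.1, ?_⟩
    rw [← hp.2]; rfl

lemma split_le {q : ℝ} (hq : 1 ≤ q) (a : U → A) (b : V → B) (T : Finset (U × V)) {R : ℝ}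
    (hR : ∀ C, Phi q (cellPart a b T C) ≤ R) (Q : A) :
    ∑ u ∈ (T.image Prod.fst).filter (fun u => a u = Q), fib T u ^ q ≤
      fib (T.image (Prod.map a b)) Q ^ q * R := by
  set F := (T.image (Prod.map a b)).filter (fun C => C.1 = Q) with hF
  have hN : fib (T.image (Prod.map a b)) Q = (F.card : ℝ) := rfl
  rw [hN]
  calc ∑ u ∈ (T.image Prod.fst).filter (fun u => a u = Q), fib T u ^ q
      ≤ ∑ u ∈ (T.image Prod.fst).filter (fun u => a u = Q),
          (F.card : ℝ) ^ (q - 1) * ∑ C ∈ F, fib (cellPart a b T C) u ^ q := by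
        refine Finset.sum_le_sum fun u hu => ?_
        have hu' := (Finset.mem_filter.1 hu).2
        rw [fib_split a b T u, hu']
        exact Real.rpow_sum_le_const_mul_sum_rpow_of_nonneg _ hq fun _ _ => fib_nonneg _ _
    _ = (F.card : ℝ) ^ (q - 1) * ∑ C ∈ F, ∑ u ∈ (T.image Prod.fst).filter (fun u => a u = Q),
          fib (cellPart a b T C) u ^ q := by
        rw [← Finset.mul_sum, Finset.sum_comm]
    _ ≤ (F.card : ℝ) ^ (q - 1) * ∑ C ∈ F, R := by
        gcongr with C hC
        exact (sum_le_phi hq _ _).trans (hR C)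
    _ = (F.card : ℝ) ^ q * R := by
        rw [Finset.sum_const, nsmul_eq_mul, ← mul_rpow_sub_one (Nat.cast_nonneg _) hq]; ring

lemma phi_split_le {q : ℝ} (hq : 1 ≤ q) (a : U → A) (b : V → B) (T : Finset (U × V)) {R : ℝ}
    (hR : ∀ C, Phi q (cellPart a b T C) ≤ R) :
    Phi q T ≤ Phi q (T.image (Prod.map a b)) * R := by
  rw [phi_image hq, phi_image hq (T.image _), Finset.sum_mul]
  rw [← Finset.sum_fiberwise_of_maps_to (t := (T.image (Prod.map a b)).image Prod.fst) (g := a)]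
  · exact Finset.sum_le_sum fun Q _ => split_le hq a b T hR Q
  · intro u hu
    obtain ⟨p, hp, rfl⟩ := Finset.mem_image.1 hu
    exact Finset.mem_image.2 ⟨Prod.map a b p, Finset.mem_image_of_mem _ hp, rfl⟩

/-- bound for the mass of the points whose fibre measure of a cell is large -/
lemma bad_fine {q : ℝ} (hq : 1 < q) (a : U → A) (b : V → B) (T : Finset (U × V)) {R t : ℝ}
    (ht : 0 < t) (hR : ∀ C, Phi q (cellPart a b T C) ≤ R) :
    ∑ p ∈ T.filter (fun p => t * fib T p.1 ≤ fib (cellPart a b T (Prod.map a b p)) p.1),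
      fib T p.1 ^ (q - 1) ≤ t ^ (-(q - 1)) * ((T.image (Prod.map a b)).card * R) := by
  calc _ ≤ ∑ p ∈ T.filter (fun p => t * fib T p.1 ≤ fib (cellPart a b T (Prod.map a b p)) p.1),
          t ^ (-(q - 1)) * fib (cellPart a b T (Prod.map a b p)) p.1 ^ (q - 1) := by
        refine Finset.sum_le_sum fun p hp => ?_
        have h := (Finset.mem_filter.1 hp).2
        have h2 := Real.rpow_le_rpow (mul_nonneg ht.le (fib_nonneg _ _)) h (z := q - 1)
          (by linarith)
        rw [Real.mul_rpow ht.le (fib_nonneg _ _)] at h2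
        have h3 : 0 < t ^ (q - 1) := Real.rpow_pos_of_pos ht _
        rw [Real.rpow_neg ht.le]
        rw [inv_mul_eq_div, le_div_iff₀ h3]
        linarith
    _ ≤ ∑ p ∈ T, t ^ (-(q - 1)) * fib (cellPart a b T (Prod.map a b p)) p.1 ^ (q - 1) := by
        refine Finset.sum_le_sum_of_subset_of_nonneg (Finset.filter_subset _ _) fun _ _ _ => ?_
        exact mul_nonneg (Real.rpow_nonneg ht.le _) (Real.rpow_nonneg (fib_nonneg _ _) _)
    _ = t ^ (-(q - 1)) * ∑ C ∈ T.image (Prod.map a b), Phi q (cellPart a b T C) := by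
        rw [← Finset.mul_sum]
        congr 1
        rw [← Finset.sum_fiberwise_of_maps_to (s := T) (t := T.image (Prod.map a b))
          (g := Prod.map a b) fun p hp => Finset.mem_image_of_mem _ hp]
        refine Finset.sum_congr rfl fun C _ => ?_
        unfold Phi
        refine Finset.sum_congr rfl fun p hp => ?_
        rw [(Finset.mem_filter.1 hp).2]
    _ ≤ t ^ (-(q - 1)) * ∑ C ∈ T.image (Prod.map a b), R := by
        gcongr with C hC
        exact hR C
    _ = _ := by rw [Finset.sum_const, nsmul_eq_mul]

/-- the mass of a base cell -/
def baseMass (q : ℝ) (a : U → A) (T : Finset (U × V)) (Q : A) : ℝ :=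
  ∑ u ∈ (T.image Prod.fst).filter (fun u => a u = Q), fib T u ^ q

lemma baseMass_nonneg (q : ℝ) (a : U → A) (T : Finset (U × V)) (Q : A) : 0 ≤ baseMass q a T Q :=
  Finset.sum_nonneg fun _ _ => Real.rpow_nonneg (fib_nonneg _ _) _

lemma bad_base {q θ : ℝ} (hq : 1 ≤ q) (hθ : 0 < θ) (a : U → A) (b : V → B) (T : Finset (U × V))
    {R s : ℝ} (hs : 0 < s) (hR0 : 0 ≤ R) (hR : ∀ C, Phi q (cellPart a b T C) ≤ R) :
    ∑ p ∈ T.filter (fun p => s ≤ baseMass q a T (a p.1)), fib T p.1 ^ (q - 1) ≤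
      s ^ (-θ) * (R ^ (1 + θ) * Phi (q * (1 + θ)) (T.image (Prod.map a b))) := by
  have hq' : 1 ≤ q * (1 + θ) := by nlinarith
  have e1 : ∑ p ∈ T.filter (fun p => s ≤ baseMass q a T (a p.1)), fib T p.1 ^ (q - 1) =
      ∑ Q ∈ (T.image (Prod.map a b)).image Prod.fst,
        if s ≤ baseMass q a T Q then baseMass q a T Q else 0 := by
    rw [Finset.sum_filter]
    rw [sum_fst T (fun u => if s ≤ baseMass q a T (a u) then fib T u ^ (q - 1) else 0)]
    rw [← Finset.sum_fiberwise_of_maps_to (t := (T.image (Prod.map a b)).image Prod.fst) (g := a)]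
    · refine Finset.sum_congr rfl fun Q _ => ?_
      split_ifs with h
      · conv_rhs => unfold baseMass
        refine Finset.sum_congr rfl fun u hu => ?_
        rw [(Finset.mem_filter.1 hu).2, if_pos h, mul_rpow_sub_one (fib_nonneg _ _) hq]
      · refine Finset.sum_eq_zero fun u hu => ?_
        rw [(Finset.mem_filter.1 hu).2, if_neg h, mul_zero]
    · intro u hu
      obtain ⟨p, hp, rfl⟩ := Finset.mem_image.1 hu
      exact Finset.mem_image.2 ⟨Prod.map a b p, Finset.mem_image_of_mem _ hp, rfl⟩
  rw [e1, phi_image hq', Finset.mul_sum, Finset.mul_sum]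
  refine Finset.sum_le_sum fun Q _ => ?_
  set N := fib (T.image (Prod.map a b)) Q
  have hN : 0 ≤ N := fib_nonneg _ _
  have hR' : 0 ≤ s ^ (-θ) * (R ^ (1 + θ) * N ^ (q * (1 + θ))) := by positivity
  split_ifs with h
  · set M := baseMass q a T Q with hM
    have hM0 : 0 < M := hs.trans_le h
    have h1 : M ≤ N ^ q * R := split_le hq a b T hR Q
    calc M = M ^ (-θ) * M ^ (1 + θ) := by
          rw [← Real.rpow_add hM0]; simp
      _ ≤ s ^ (-θ) * (N ^ q * R) ^ (1 + θ) := by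
          have h2 : M ^ (-θ) ≤ s ^ (-θ) :=
            Real.rpow_le_rpow_of_nonpos hs h (by linarith)
          have h3 : M ^ (1 + θ) ≤ (N ^ q * R) ^ (1 + θ) :=
            Real.rpow_le_rpow hM0.le h1 (by linarith)
          gcongr
      _ = _ := by
          rw [Real.mul_rpow (by positivity) hR0, ← Real.rpow_mul hN]; ring
  · exact hR'

/-- The finite combinatorial core. -/
lemma finite_core {q θ : ℝ} (hq : 1 < q) (hθ : 0 < θ) (T : Finset (U × V)) (hT : T.Nonempty)
    (n : ℕ) (a : ℕ → U → A) (b : ℕ → V → B) (R t s : ℕ → ℝ)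
    (ht : ∀ k, 0 < t k) (hs : ∀ k, 0 < s k)
    (hR : ∀ k ≤ n, ∀ C, Phi q (cellPart (a k) (b k) T C) ≤ R k)
    (h1 : ∑ k ∈ Finset.range (n + 1), t k ^ (-(q - 1)) *
      ((T.image (Prod.map (a k) (b k))).card * R k) ≤ Phi q T / 4)
    (h2 : ∑ k ∈ Finset.range (n + 1), s k ^ (-θ) * ((R k / Phi q T) ^ (1 + θ) *
      Phi (q * (1 + θ)) (T.image (Prod.map (a k) (b k)))) ≤ 1 / 4) :
    ∃ Y : Finset U,
      (∀ J : Finset (ℕ × A), (∀ j ∈ J, j.1 ≤ n) → (∀ u ∈ Y, ∃ j ∈ J, a j.1 u = j.2) →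
        1 / 4 ≤ ∑ j ∈ J, s j.1) ∧
      (∀ u ∈ Y, ∀ J : Finset (ℕ × B), (∀ j ∈ J, j.1 ≤ n) →
        (∀ v, (u, v) ∈ T → ∃ j ∈ J, b j.1 v = j.2) → 1 / 4 ≤ ∑ j ∈ J, t j.1) := by
  set P := Phi q T with hP
  have hP0 : 0 < P := by
    have := card_le_phi hq.le T
    have h : (0 : ℝ) < T.card := by exact_mod_cast hT.card_pos
    linarith
  set w : U × V → ℝ := fun p => fib T p.1 ^ (q - 1) with hw
  have hw0 : ∀ p, 0 ≤ w p := fun p => Real.rpow_nonneg (fib_nonneg _ _) _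
  set bf : ℕ → Finset (U × V) := fun k => T.filter
    (fun p => t k * fib T p.1 ≤ fib (cellPart (a k) (b k) T (Prod.map (a k) (b k) p)) p.1) with hbf
  set bb : ℕ → Finset (U × V) := fun k => T.filter
    (fun p => s k * P ≤ baseMass q (a k) T (a k p.1)) with hbb
  set I := Finset.range (n + 1)
  set bad := I.biUnion (fun k => bf k ∪ bb k) with hbad
  have hbfs : ∑ k ∈ I, ∑ p ∈ bf k, w p ≤ P / 4 := by
    refine le_trans (Finset.sum_le_sum fun k hk => ?_) h1
    exact bad_fine hq (a k) (b k) T (ht k) (hR k (by simpa [I, Nat.lt_succ_iff] using hk))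
  have hbbs : ∑ k ∈ I, ∑ p ∈ bb k, w p ≤ P / 4 := by
    have : ∑ k ∈ I, ∑ p ∈ bb k, w p ≤ ∑ k ∈ I, P * (s k ^ (-θ) * ((R k / P) ^ (1 + θ) *
      Phi (q * (1 + θ)) (T.image (Prod.map (a k) (b k))))) := by
      refine Finset.sum_le_sum fun k hk => ?_
      have hRk := hR k (by simpa [I, Nat.lt_succ_iff] using hk)
      obtain ⟨p, hp⟩ := hT
      have hR0 : 0 ≤ R k := (phi_nonneg _ _).trans (hRk (Prod.map (a k) (b k) p))
      refine (bad_base hq.le hθ (a k) (b k) T (mul_pos (hs k) hP0) hR0 hRk).trans (le_of_eq ?_)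
      rw [Real.mul_rpow (hs k).le hP0.le, Real.div_rpow hR0 hP0.le, Real.rpow_add hP0,
        Real.rpow_neg hP0.le, Real.rpow_one]
      have : P ^ θ ≠ 0 := (Real.rpow_pos_of_pos hP0 _).ne'
      field_simp
    rw [← Finset.mul_sum] at this
    nlinarith
  have hbads : ∑ p ∈ bad, w p ≤ P / 2 := by
    calc ∑ p ∈ bad, w p ≤ ∑ k ∈ I, ∑ p ∈ bf k ∪ bb k, w p := by
          exact sum_biUnion_le' _ _ _ hw0
      _ ≤ ∑ k ∈ I, (∑ p ∈ bf k, w p + ∑ p ∈ bb k, w p) := by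
          refine Finset.sum_le_sum fun k _ => ?_
          rw [← Finset.sum_union_inter]
          exact le_add_of_nonneg_right (Finset.sum_nonneg fun p _ => hw0 p)
      _ ≤ P / 2 := by rw [Finset.sum_add_distrib]; linarith
  set G := T \ bad with hG
  have hGs : P / 2 ≤ ∑ p ∈ G, w p := by
    have h := Finset.sum_inter_add_sum_sdiff T bad w
    have h' : ∑ p ∈ T ∩ bad, w p ≤ ∑ p ∈ bad, w p :=
      Finset.sum_le_sum_of_subset_of_nonneg Finset.inter_subset_right fun p _ _ => hw0 p
    have h'' : ∑ p ∈ T, w p = P := rfl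
    linarith
  set Y := (T.image Prod.fst).filter (fun u => fib T u / 4 ≤ fib G u) with hY
  have hYm : P / 4 ≤ ∑ u ∈ Y, fib T u ^ q := by
    have hGT : G.image Prod.fst ⊆ T.image Prod.fst := Finset.image_subset_image Finset.sdiff_subset
    have e : ∑ p ∈ G, w p = ∑ u ∈ T.image Prod.fst, fib G u * fib T u ^ (q - 1) := by
      rw [hw, sum_fst G (fun u => fib T u ^ (q - 1))]
      refine Finset.sum_subset hGT fun u _ hu => ?_
      rw [fib_eq_zero hu, zero_mul]
    have hle : ∀ u, fib G u ≤ fib T u := fun u => by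
      unfold fib
      exact_mod_cast Finset.card_le_card (Finset.filter_subset_filter _ Finset.sdiff_subset)
    rw [← Finset.sum_filter_add_sum_filter_not (T.image Prod.fst)
      (fun u => fib T u / 4 ≤ fib G u)] at e
    have h3 : ∑ u ∈ Y, fib G u * fib T u ^ (q - 1) ≤ ∑ u ∈ Y, fib T u ^ q := by
      refine Finset.sum_le_sum fun u _ => ?_
      rw [← mul_rpow_sub_one (fib_nonneg T u) hq.le]
      exact mul_le_mul_of_nonneg_right (hle u) (Real.rpow_nonneg (fib_nonneg _ _) _)
    have h4 : ∑ u ∈ (T.image Prod.fst).filter (fun u => ¬ fib T u / 4 ≤ fib G u),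
        fib G u * fib T u ^ (q - 1) ≤ P / 4 := by
      calc _ ≤ ∑ u ∈ (T.image Prod.fst).filter (fun u => ¬ fib T u / 4 ≤ fib G u),
            fib T u ^ q / 4 := by
            refine Finset.sum_le_sum fun u hu => ?_
            have := (Finset.mem_filter.1 hu).2
            rw [← mul_rpow_sub_one (fib_nonneg T u) hq.le]
            have h5 := mul_le_mul_of_nonneg_right (not_le.1 this).le
              (Real.rpow_nonneg (fib_nonneg T u) (q - 1))
            linarith
        _ = (∑ u ∈ (T.image Prod.fst).filter (fun u => ¬ fib T u / 4 ≤ fib G u),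
            fib T u ^ q) / 4 := by rw [Finset.sum_div]
        _ ≤ P / 4 := by
            have := sum_le_phi hq.le T
              ((T.image Prod.fst).filter (fun u => ¬ fib T u / 4 ≤ fib G u))
            linarith
    rw [← hY] at e
    linarith
  have hYG : ∀ u ∈ Y, ∃ p ∈ G, p.1 = u := by
    intro u hu
    obtain ⟨hu1, hu2⟩ := Finset.mem_filter.1 hu
    obtain ⟨p, hp, rfl⟩ := Finset.mem_image.1 hu1
    have h5 := one_le_fib hp
    have h6 : 0 < fib G p.1 := by linarith
    unfold fib at h6
    obtain ⟨p', hp'⟩ := Finset.card_pos.1 (by exact_mod_cast h6)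
    exact ⟨p', (Finset.mem_filter.1 hp').1, (Finset.mem_filter.1 hp').2⟩
  have hGgood : ∀ p ∈ G, p ∈ T ∧ ∀ k ≤ n,
      fib (cellPart (a k) (b k) T (Prod.map (a k) (b k) p)) p.1 < t k * fib T p.1 ∧
      baseMass q (a k) T (a k p.1) < s k * P := by
    intro p hp
    obtain ⟨hpT, hpb⟩ := Finset.mem_sdiff.1 hp
    refine ⟨hpT, fun k hk => ?_⟩
    by_contra hcon
    apply hpb
    refine Finset.mem_biUnion.2 ⟨k, by simp [I]; omega, ?_⟩
    rw [Finset.mem_union]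
    rw [not_and_or, not_lt, not_lt] at hcon
    rcases hcon with h | h
    · exact Or.inl (Finset.mem_filter.2 ⟨hpT, h⟩)
    · exact Or.inr (Finset.mem_filter.2 ⟨hpT, h⟩)
  refine ⟨Y, ?_, ?_⟩
  · intro J hJ hcov
    have key : ∑ u ∈ Y, fib T u ^ q ≤ ∑ j ∈ J, s j.1 * P := by
      calc ∑ u ∈ Y, fib T u ^ q
          ≤ ∑ u ∈ J.biUnion (fun j => Y.filter (fun u => a j.1 u = j.2)), fib T u ^ q := by
            refine Finset.sum_le_sum_of_subset_of_nonneg ?_ fun _ _ _ =>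
              Real.rpow_nonneg (fib_nonneg _ _) _
            intro u hu
            obtain ⟨j, hj, h⟩ := hcov u hu
            exact Finset.mem_biUnion.2 ⟨j, hj, Finset.mem_filter.2 ⟨hu, h⟩⟩
        _ ≤ ∑ j ∈ J, ∑ u ∈ Y.filter (fun u => a j.1 u = j.2), fib T u ^ q :=
            sum_biUnion_le' _ _ _ fun _ => Real.rpow_nonneg (fib_nonneg _ _) _
        _ ≤ ∑ j ∈ J, s j.1 * P := by
            refine Finset.sum_le_sum fun j hj => ?_
            rcases (Y.filter (fun u => a j.1 u = j.2)).eq_empty_or_nonempty with he | ⟨u, hu⟩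
            · rw [he, Finset.sum_empty]; exact (mul_pos (hs _) hP0).le
            · obtain ⟨huY, huj⟩ := Finset.mem_filter.1 hu
              obtain ⟨p, hp, rfl⟩ := hYG u huY
              have := ((hGgood p hp).2 j.1 (hJ j hj)).2
              rw [huj] at this
              refine le_trans ?_ this.le
              unfold baseMass
              refine Finset.sum_le_sum_of_subset_of_nonneg ?_ fun _ _ _ =>
                Real.rpow_nonneg (fib_nonneg _ _) _
              exact Finset.filter_subset_filter _ (Finset.filter_subset _ _)
    rw [← Finset.sum_mul] at key
    nlinarith
  · intro u hu J hJ hcov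
    obtain ⟨hu1, hu2⟩ := Finset.mem_filter.1 hu
    have hfu : 1 ≤ fib T u := by
      obtain ⟨p, hp, rfl⟩ := Finset.mem_image.1 hu1
      exact one_le_fib hp
    have key : fib G u ≤ ∑ j ∈ J, t j.1 * fib T u := by
      have hsub : G.filter (fun p => p.1 = u) ⊆
          J.biUnion (fun j => (G.filter (fun p => p.1 = u)).filter (fun p => b j.1 p.2 = j.2)) := by
        intro p hp
        obtain ⟨hpG, hpu⟩ := Finset.mem_filter.1 hp
        obtain ⟨j, hj, h⟩ := hcov p.2 (by rw [← hpu]; exact (hGgood p hpG).1)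
        exact Finset.mem_biUnion.2 ⟨j, hj, Finset.mem_filter.2 ⟨hp, h⟩⟩
      calc fib G u ≤ ∑ j ∈ J,
            (((G.filter (fun p => p.1 = u)).filter (fun p => b j.1 p.2 = j.2)).card : ℝ) := by
            unfold fib
            exact_mod_cast (Finset.card_le_card hsub).trans Finset.card_biUnion_le
        _ ≤ _ := by
            refine Finset.sum_le_sum fun j hj => ?_
            rcases ((G.filter (fun p => p.1 = u)).filter
              (fun p => b j.1 p.2 = j.2)).eq_empty_or_nonempty with he | ⟨p, hp⟩
            · rw [he, Finset.card_empty, Nat.cast_zero]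
              exact mul_nonneg (ht _).le (by linarith)
            · obtain ⟨hp1, hpj⟩ := Finset.mem_filter.1 hp
              obtain ⟨hpG, hpu⟩ := Finset.mem_filter.1 hp1
              have := ((hGgood p hpG).2 j.1 (hJ j hj)).1
              rw [hpu] at this
              refine le_trans ?_ this.le
              unfold fib
              rw [Nat.cast_le]
              refine Finset.card_le_card fun p' hp' => ?_
              obtain ⟨hp1', hpj'⟩ := Finset.mem_filter.1 hp'
              obtain ⟨hpG', hpu'⟩ := Finset.mem_filter.1 hp1'
              refine Finset.mem_filter.2 ⟨Finset.mem_filter.2 ⟨(hGgood p' hpG').1, ?_⟩, hpu'⟩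
              ext
              · simp [hpu, hpu']
              · simp [hpj, hpj']
    rw [← Finset.sum_mul] at key
    nlinarith

end FiniteCore

section Growth

lemma poly_bound {ε : ℝ} (hε : 0 < ε) :
    ∃ C : ℝ, 0 < C ∧ ∀ k : ℕ, ((k : ℝ) + 2) ^ 4 ≤ C * (2 : ℝ) ^ ((k : ℝ) * ε) := by
  have hl : 0 < Real.log 2 := Real.log_pos (by norm_num)
  set c := ε * Real.log 2 / 4 with hc
  have hc0 : 0 < c := by positivity
  refine ⟨(2 + 1 / c) ^ 4, by positivity, fun k => ?_⟩
  have h1 : (k : ℝ) + 2 ≤ (2 + 1 / c) * Real.exp (k * c) := by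
    have h := Real.add_one_le_exp ((k : ℝ) * c)
    have hk : (0 : ℝ) ≤ k := Nat.cast_nonneg _
    calc (k : ℝ) + 2 ≤ (2 + 1 / c) * (k * c + 1) := by
          have : (2 + 1 / c) * (k * c + 1) = k + 2 + (2 * (k * c) + 1 / c) := by
            field_simp; ring
          rw [this]
          have : 0 ≤ 2 * (k * c) + 1 / c := by positivity
          linarith
      _ ≤ _ := by gcongr
  calc ((k : ℝ) + 2) ^ 4 ≤ ((2 + 1 / c) * Real.exp (k * c)) ^ 4 := by gcongr
    _ = (2 + 1 / c) ^ 4 * (2 : ℝ) ^ ((k : ℝ) * ε) := by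
        rw [mul_pow, ← Real.exp_nat_mul, Real.rpow_def_of_pos (by norm_num)]
        congr 2
        rw [hc]; push_cast; ring

lemma exp_compare {x y C : ℝ} (h : ∀ n : ℕ, (2 : ℝ) ^ ((n : ℝ) * x) ≤ C * (2 : ℝ) ^ ((n : ℝ) * y)) :
    x ≤ y := by
  by_contra hlt
  push Not at hlt
  have h2 : ∀ n : ℕ, ((2 : ℝ) ^ (x - y)) ^ n ≤ C := by
    intro n
    rw [← Real.rpow_natCast, ← Real.rpow_mul (by norm_num)]
    have := h n
    rw [show (x - y) * (n : ℝ) = n * x - n * y by ring, Real.rpow_sub (by norm_num),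
      div_le_iff₀ (by positivity)]
    exact this
  have h3 : 1 < (2 : ℝ) ^ (x - y) := Real.one_lt_rpow (by norm_num) (by linarith)
  obtain ⟨n, hn⟩ := pow_unbounded_of_one_lt C h3
  exact absurd (h2 n) (not_le.2 hn)

lemma growth (P : ℕ → ℝ) (h1 : ∀ n, 1 ≤ P n) (hsub : ∀ k l, P (k + l) ≤ P k * P l) :
    ∃ L : ℝ, 0 ≤ L ∧ (∀ n : ℕ, (2 : ℝ) ^ ((n : ℝ) * L) ≤ P n) ∧
      (∀ ε > 0, ∃ C : ℝ, 0 < C ∧ ∀ n : ℕ, P n ≤ C * (2 : ℝ) ^ ((n : ℝ) * (L + ε))) ∧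
      (∀ N : ℕ, ∃ n ≥ N, ∀ k ≤ n, P (n - k) ≤ ((k : ℝ) + 1) * (2 : ℝ) ^ (-((k : ℝ) * L)) * P n) := by
  have hP0 : ∀ n, 0 < P n := fun n => lt_of_lt_of_le one_pos (h1 n)
  have hS : Subadditive (fun n => Real.logb 2 (P n)) := by
    intro k l
    simp only
    rw [← Real.logb_mul (hP0 k).ne' (hP0 l).ne']
    exact Real.logb_le_logb_of_le (by norm_num) (hP0 _) (hsub k l)
  have hb : BddBelow (range fun n : ℕ => Real.logb 2 (P n) / n) := by
    refine ⟨0, ?_⟩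
    rintro _ ⟨n, rfl⟩
    exact div_nonneg (Real.logb_nonneg (by norm_num) (h1 n)) (Nat.cast_nonneg _)
  have hlow : ∀ n : ℕ, (2 : ℝ) ^ ((n : ℝ) * hS.lim) ≤ P n := by
    intro n
    rcases Nat.eq_zero_or_pos n with rfl | hn
    · simpa using h1 0
    · have h := hS.lim_le_div hb hn.ne'
      have hn' : (0 : ℝ) < n := by exact_mod_cast hn
      rw [le_div_iff₀ hn'] at h
      rw [← Real.le_logb_iff_rpow_le (by norm_num) (hP0 n)]
      linarith
  refine ⟨hS.lim, ?_, hlow, ?_, ?_⟩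
  · exact ge_of_tendsto' (hS.tendsto_lim hb) fun n =>
      div_nonneg (Real.logb_nonneg (by norm_num) (h1 n)) (Nat.cast_nonneg _)
  · intro ε hε
    have hev := (hS.tendsto_lim hb).eventually_lt_const (show hS.lim < hS.lim + ε by linarith)
    obtain ⟨N, hN⟩ := eventually_atTop.1 hev
    set L := hS.lim
    have hsum0 : ∀ n, 0 < P n / (2 : ℝ) ^ ((n : ℝ) * (L + ε)) := fun n =>
      div_pos (hP0 n) (Real.rpow_pos_of_pos (by norm_num) _)
    refine ⟨1 + ∑ n ∈ Finset.range (N + 1), P n / (2 : ℝ) ^ ((n : ℝ) * (L + ε)), ?_, ?_⟩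
    · have := Finset.sum_nonneg (s := Finset.range (N + 1)) fun n _ => (hsum0 n).le
      linarith
    · intro n
      have hpos : 0 < (2 : ℝ) ^ ((n : ℝ) * (L + ε)) := Real.rpow_pos_of_pos (by norm_num) _
      rw [← div_le_iff₀ hpos]
      by_cases hn : n < N + 1
      · have := Finset.single_le_sum (f := fun n : ℕ => P n / (2 : ℝ) ^ ((n : ℝ) * (L + ε)))
          (fun n _ => (hsum0 n).le) (Finset.mem_range.2 hn)
        have h5 : P n / (2 : ℝ) ^ ((n : ℝ) * (L + ε)) ≤ _ := this
        linarith
      · have h := hN n (by omega)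
        have hn' : (0 : ℝ) < n := by exact_mod_cast (show 0 < n by omega)
        rw [div_lt_iff₀ hn'] at h
        have h' := (Real.logb_lt_iff_lt_rpow (by norm_num) (hP0 n)).1 h
        rw [mul_comm] at h'
        have := Finset.sum_nonneg (s := Finset.range (N + 1)) fun n _ => (hsum0 n).le
        have h3 : P n / (2 : ℝ) ^ ((n : ℝ) * (L + ε)) ≤ 1 := by
          rw [div_le_one hpos]; exact h'.le
        linarith
  · intro N
    by_contra hcon
    push Not at hcon
    set L := hS.lim
    set E : ℕ → ℝ := fun n => P n / (2 : ℝ) ^ ((n : ℝ) * L) with hE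
    have hpos : ∀ n : ℕ, 0 < (2 : ℝ) ^ ((n : ℝ) * L) := fun n => Real.rpow_pos_of_pos (by norm_num) _
    have hE1 : ∀ n, 1 ≤ E n := fun n => by rw [hE]; simp only; rw [one_le_div (hpos n)]; exact hlow n
    have hstep : ∀ n ≥ N, ∃ k ≤ n, ((k : ℝ) + 1) * E n < E (n - k) := by
      intro n hn
      obtain ⟨k, hk, h⟩ := hcon n hn
      refine ⟨k, hk, ?_⟩
      simp only [hE]
      rw [lt_div_iff₀ (hpos _)]
      refine lt_of_eq_of_lt ?_ h
      have : (2 : ℝ) ^ ((n : ℝ) * L) =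
          (2 : ℝ) ^ (((n - k : ℕ) : ℝ) * L) * (2 : ℝ) ^ ((k : ℝ) * L) := by
        rw [← Real.rpow_add (by norm_num), Nat.cast_sub hk]; congr 1; ring
      rw [this, Real.rpow_neg (by norm_num)]
      have h2 := (hpos (n - k)).ne'
      have h3 := (hpos k).ne'
      field_simp
    set B := ∑ m ∈ Finset.range N, E m + E 0
    have hB : ∀ n, E n * (1 + ((n - N : ℕ) : ℝ)) ≤ B := by
      intro n
      induction n using Nat.strong_induction_on with
      | _ n ih =>
        by_cases hn : n < N
        · have h0 : n - N = 0 := by omega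
          rw [h0]
          have := Finset.single_le_sum (f := E) (fun n _ => zero_le_one.trans (hE1 n))
            (Finset.mem_range.2 hn)
          have h2 := hE1 0
          simp only [Nat.cast_zero, add_zero, mul_one]
          linarith
        · obtain ⟨k, hk, h⟩ := hstep n (by omega)
          have hk0 : k ≠ 0 := by
            rintro rfl
            simp at h
          have hi := ih (n - k) (by omega)
          refine le_trans ?_ hi
          have hD : (1 + ((n - N : ℕ) : ℝ)) ≤ ((k : ℝ) + 1) * (1 + ((n - k - N : ℕ) : ℝ)) := by
            have : n - N ≤ (n - k - N) + k := by omega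
            have h' : ((n - N : ℕ) : ℝ) ≤ ((n - k - N : ℕ) : ℝ) + k := by exact_mod_cast this
            have h1 : (0 : ℝ) ≤ ((n - k - N : ℕ) : ℝ) := Nat.cast_nonneg _
            have h2 : (0 : ℝ) ≤ k := Nat.cast_nonneg _
            nlinarith
          have hEn := hE1 n
          calc E n * (1 + ((n - N : ℕ) : ℝ))
              ≤ E n * (((k : ℝ) + 1) * (1 + ((n - k - N : ℕ) : ℝ))) := by gcongr
            _ = (((k : ℝ) + 1) * E n) * (1 + ((n - k - N : ℕ) : ℝ)) := by ring
            _ ≤ _ := by gcongr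
    obtain ⟨j, hj⟩ := exists_nat_gt B
    have h := hB (N + j)
    rw [show N + j - N = j by omega] at h
    have := hE1 (N + j)
    have h4 : (0 : ℝ) ≤ j := Nat.cast_nonneg _
    nlinarith

lemma gauge_rpow {p M : ℝ} (hp : 0 < p) (x : ℕ → ℝ) (hx : ∀ k, 0 < x k)
    (h : ∀ ε > 0, ∃ C : ℝ, 0 < C ∧ ∀ k : ℕ, x k ≤ C * (2 : ℝ) ^ (-((k : ℝ) * (M - ε)))) :
    ∀ ε > 0, ∃ C : ℝ, 0 < C ∧ ∀ k : ℕ, x k ^ (1 / p) ≤ C * (2 : ℝ) ^ (-((k : ℝ) * (M / p - ε))) := by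
  intro ε hε
  obtain ⟨C, hC, h⟩ := h (ε * p) (by positivity)
  refine ⟨C ^ (1 / p), by positivity, fun k => ?_⟩
  calc x k ^ (1 / p) ≤ (C * (2 : ℝ) ^ (-((k : ℝ) * (M - ε * p)))) ^ (1 / p) :=
        Real.rpow_le_rpow (hx k).le (h k) (by positivity)
    _ = _ := by
        rw [Real.mul_rpow hC.le (by positivity), ← Real.rpow_mul (by norm_num)]
        congr 2
        field_simp

lemma sum_inv_le (n : ℕ) : ∑ k ∈ Finset.range n, 1 / (((k : ℝ) + 1) * ((k : ℝ) + 2)) ≤ 1 := by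
  have : ∑ k ∈ Finset.range n, 1 / (((k : ℝ) + 1) * ((k : ℝ) + 2)) = 1 - 1 / ((n : ℝ) + 1) := by
    induction n with
    | zero => simp
    | succ n ih =>
      rw [Finset.sum_range_succ, ih]
      push_cast
      field_simp
      ring
  rw [this]
  have : 0 ≤ 1 / ((n : ℝ) + 1) := by positivity
  linarith

end Growth

section Labels

variable {σ ι κ : Type*} [Fintype σ] [Fintype ι] [Fintype κ]
  [DecidableEq σ] [DecidableEq ι] [DecidableEq κ]

/-- dyadic label of level `k` -/
def lab (k : ℕ) (x : σ → ℝ) : σ → ℤ := fun i => ⌊(2 : ℝ) ^ k * x i⌋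

/-- truncation of a label by `l` levels -/
def tr (l : ℕ) (u : σ → ℤ) : σ → ℤ := fun i => u i / 2 ^ l

lemma tr_lab (k l : ℕ) (x : σ → ℝ) : tr l (lab (k + l) x) = lab k x := by
  funext i
  simp only [tr, lab]
  have := Int.natCast_mul_floor_div_cancel (n := 2 ^ l) (by positivity) ((2 : ℝ) ^ k * x i)
  push_cast at this
  rw [show (2 : ℝ) ^ (k + l) * x i = 2 ^ l * (2 ^ k * x i) by rw [pow_add]; ring]
  exact this

lemma lab_zoom (k l : ℕ) (x : σ → ℝ) (w : σ → ℤ) :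
    lab l (fun i => (2 : ℝ) ^ k * x i - w i) = fun i => lab (k + l) x i - 2 ^ l * w i := by
  funext i
  simp only [lab]
  rw [← Int.floor_sub_intCast]
  congr 1
  push_cast
  ring

lemma lab_zero_iff (x : σ → ℝ) : lab 0 x = 0 ↔ ∀ i, 0 ≤ x i ∧ x i < 1 := by
  simp only [lab, funext_iff, pow_zero, one_mul, Pi.zero_apply, Int.floor_eq_zero_iff, Set.mem_Ico]

/-- the box of possible labels -/
def lbox (σ : Type*) [Fintype σ] [DecidableEq σ] (n : ℕ) : Finset (σ → ℤ) :=
  Fintype.piFinset fun _ => Finset.Ico 0 (2 ^ n)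

lemma lab_mem_lbox {x : σ → ℝ} (hx : lab 0 x = 0) (n : ℕ) : lab n x ∈ lbox σ n := by
  rw [lab_zero_iff] at hx
  simp only [lbox, Fintype.mem_piFinset, Finset.mem_Ico, lab]
  intro i
  have hp : (0 : ℝ) < 2 ^ n := by positivity
  refine ⟨Int.floor_nonneg.2 (mul_nonneg hp.le (hx i).1), Int.floor_lt.2 ?_⟩
  push_cast
  nlinarith [(hx i).2]

open Classical in
/-- the labels of level `n` hit by `Z` -/
def hits (n : ℕ) (Z : Set ((ι → ℝ) × (κ → ℝ))) : Finset ((ι → ℤ) × (κ → ℤ)) :=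
  (lbox ι n ×ˢ lbox κ n).filter (fun p => ∃ z ∈ Z, (lab n z.1, lab n z.2) = p)

/-- rescaled part of `Z` in a dyadic cell -/
def zoom (k : ℕ) (C : (ι → ℤ) × (κ → ℤ)) (Z : Set ((ι → ℝ) × (κ → ℝ))) :
    Set ((ι → ℝ) × (κ → ℝ)) :=
  {z' | ∃ z ∈ Z, lab k z.1 = C.1 ∧ lab k z.2 = C.2 ∧
    z' = (fun i => (2 : ℝ) ^ k * z.1 i - C.1 i, fun i => (2 : ℝ) ^ k * z.2 i - C.2 i)}

/-- a family of subsets of the unit box closed under zooming -/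
structure ZoomFamily (F : Set (Set ((ι → ℝ) × (κ → ℝ)))) : Prop where
  unit : ∀ Z ∈ F, ∀ z ∈ Z, lab 0 z.1 = 0 ∧ lab 0 z.2 = 0
  zoom : ∀ Z ∈ F, ∀ k C, zoom k C Z ∈ F
  nonempty : ∃ Z ∈ F, Z.Nonempty

variable {F : Set (Set ((ι → ℝ) × (κ → ℝ)))}

lemma mem_hits (hF : ZoomFamily F) {Z} (hZ : Z ∈ F) {n : ℕ} {p : (ι → ℤ) × (κ → ℤ)} :
    p ∈ hits n Z ↔ ∃ z ∈ Z, (lab n z.1, lab n z.2) = p := by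
  simp only [hits, Finset.mem_filter, Finset.mem_product, and_iff_right_iff_imp]
  rintro ⟨z, hz, rfl⟩
  obtain ⟨h1, h2⟩ := hF.unit Z hZ z hz
  exact ⟨lab_mem_lbox h1 n, lab_mem_lbox h2 n⟩

lemma hits_image (hF : ZoomFamily F) {Z} (hZ : Z ∈ F) (k l : ℕ) :
    (hits (k + l) Z).image (Prod.map (tr l) (tr l)) = hits k Z := by
  ext p
  rw [Finset.mem_image, mem_hits hF hZ]
  constructor
  · rintro ⟨p', hp', rfl⟩
    obtain ⟨z, hz, rfl⟩ := (mem_hits hF hZ).1 hp'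
    exact ⟨z, hz, by simp [tr_lab]⟩
  · rintro ⟨z, hz, rfl⟩
    exact ⟨(lab (k + l) z.1, lab (k + l) z.2), (mem_hits hF hZ).2 ⟨z, hz, rfl⟩, by simp [tr_lab]⟩

/-- the maximal `L^q` sum of level `n` over the family -/
def PP (F : Set (Set ((ι → ℝ) × (κ → ℝ)))) (q : ℝ) (n : ℕ) : ℝ :=
  sSup ((fun Z => Phi q (hits n Z)) '' F)

lemma PP_finite (F : Set (Set ((ι → ℝ) × (κ → ℝ)))) (q : ℝ) (n : ℕ) :
    ((fun Z => Phi q (hits n Z)) '' F).Finite := by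
  have : (fun Z => Phi q (hits n Z)) '' F ⊆
      (fun T => Phi q T) '' ((lbox ι n ×ˢ lbox κ n).powerset : Set (Finset ((ι → ℤ) × (κ → ℤ)))) := by
    rintro _ ⟨Z, _, rfl⟩
    refine ⟨hits n Z, ?_, rfl⟩
    simp only [Finset.mem_coe, Finset.mem_powerset]
    unfold hits
    classical
    exact Finset.filter_subset _ _
  exact Set.Finite.subset (Set.Finite.image _ (Finset.finite_toSet _)) this

lemma phi_le_PP {Z} (hZ : Z ∈ F) (q : ℝ) (n : ℕ) : Phi q (hits n Z) ≤ PP F q n :=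
  le_csSup (PP_finite F q n).bddAbove ⟨Z, hZ, rfl⟩

lemma PP_attained (hF : ZoomFamily F) (q : ℝ) (n : ℕ) : ∃ Z ∈ F, Phi q (hits n Z) = PP F q n := by
  obtain ⟨Z, hZ, _⟩ := hF.nonempty
  obtain ⟨Z', hZ', h⟩ := Set.Nonempty.csSup_mem (s := (fun Z => Phi q (hits n Z)) '' F)
    ⟨_, ⟨Z, hZ, rfl⟩⟩ (PP_finite F q n)
  exact ⟨Z', hZ', h⟩

lemma one_le_PP (hF : ZoomFamily F) {q : ℝ} (hq : 1 ≤ q) (n : ℕ) : 1 ≤ PP F q n := by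
  obtain ⟨Z, hZ, z, hz⟩ := hF.nonempty
  refine le_trans ?_ (phi_le_PP hZ q n)
  refine le_trans ?_ (card_le_phi hq _)
  have : 0 < (hits n Z).card := Finset.card_pos.2 ⟨_, (mem_hits hF hZ).2 ⟨z, hz, rfl⟩⟩
  exact_mod_cast this

lemma phi_map_le {U V U' V' : Type*} [DecidableEq U] [DecidableEq V] [DecidableEq U']
    [DecidableEq V'] {q : ℝ} (hq : 1 ≤ q) (T : Finset (U × V)) (T' : Finset (U' × V'))
    (f : U → U') (g : V → V') (hf : Function.Injective f) (hg : Function.Injective g)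
    (h : ∀ p ∈ T, (f p.1, g p.2) ∈ T') : Phi q T ≤ Phi q T' := by
  rw [phi_image hq]
  calc ∑ u ∈ T.image Prod.fst, fib T u ^ q ≤ ∑ u ∈ T.image Prod.fst, fib T' (f u) ^ q := by
        refine Finset.sum_le_sum fun u _ => Real.rpow_le_rpow (fib_nonneg _ _) ?_ (by linarith)
        unfold fib
        rw [Nat.cast_le]
        refine Finset.card_le_card_of_injOn (Prod.map f g) ?_ (hf.prodMap hg).injOn
        intro p hp
        simp only [Finset.coe_filter, Set.mem_ofPred_eq] at hp ⊢
        exact ⟨h p hp.1, by simp [hp.2]⟩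
    _ = ∑ u ∈ (T.image Prod.fst).image f, fib T' u ^ q := by
        rw [Finset.sum_image hf.injOn]
    _ ≤ _ := sum_le_phi hq _ _

lemma cell_le (hF : ZoomFamily F) {q : ℝ} (hq : 1 ≤ q) {Z} (hZ : Z ∈ F) (k l : ℕ)
    (C : (ι → ℤ) × (κ → ℤ)) :
    Phi q (cellPart (tr l) (tr l) (hits (k + l) Z) C) ≤ PP F q l := by
  refine le_trans ?_ (phi_le_PP (hF.zoom Z hZ k C) q l)
  refine phi_map_le hq _ _ (fun u i => u i - 2 ^ l * C.1 i) (fun v i => v i - 2 ^ l * C.2 i) ?_ ?_ ?_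
  · intro u u' h
    funext i
    have := congrFun h i
    simpa using this
  · intro u u' h
    funext i
    have := congrFun h i
    simpa using this
  · intro p hp
    obtain ⟨hp1, hp2⟩ := Finset.mem_filter.1 hp
    obtain ⟨z, hz, rfl⟩ := (mem_hits hF hZ).1 hp1
    simp only [Prod.map, tr_lab] at hp2
    rw [mem_hits hF (hF.zoom Z hZ k C)]
    refine ⟨_, ⟨z, hz, by rw [← hp2], by rw [← hp2], rfl⟩, ?_⟩
    simp only [lab_zoom]

lemma PP_submul (hF : ZoomFamily F) {q : ℝ} (hq : 1 ≤ q) (k l : ℕ) :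
    PP F q (k + l) ≤ PP F q k * PP F q l := by
  obtain ⟨Z, hZ, h⟩ := PP_attained hF q (k + l)
  rw [← h]
  refine (phi_split_le hq (tr l) (tr l) _ (cell_le hF hq hZ k l)).trans ?_
  rw [hits_image hF hZ]
  have := one_le_PP hF hq l
  have h2 := phi_le_PP hZ q k
  gcongr

end Labels

section Core

/-- auxiliary gauge sequence -/
def gau (e L : ℝ) (Q : ℕ → ℝ) (k : ℕ) : ℝ :=
  4 * (((k : ℝ) + 1) * ((k : ℝ) + 2)) * ((((k : ℝ) + 1) * (2 : ℝ) ^ (-((k : ℝ) * L))) ^ e * Q k)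

lemma gau_pos {e L : ℝ} {Q : ℕ → ℝ} (hQ : ∀ k, 0 < Q k) (k : ℕ) : 0 < gau e L Q k := by
  unfold gau
  have := hQ k
  positivity

lemma gau_bound {e L l : ℝ} (he2 : e ≤ 2) {Q : ℕ → ℝ} (hQ : ∀ k, 0 < Q k)
    (h : ∀ ε > 0, ∃ C : ℝ, 0 < C ∧ ∀ k : ℕ, Q k ≤ C * (2 : ℝ) ^ ((k : ℝ) * (l + ε))) :
    ∀ ε > 0, ∃ C : ℝ, 0 < C ∧ ∀ k : ℕ,
      gau e L Q k ≤ C * (2 : ℝ) ^ (-((k : ℝ) * (e * L - l - ε))) := by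
  intro ε hε
  obtain ⟨C, hC, h⟩ := h (ε / 2) (by positivity)
  obtain ⟨D, hD, hd⟩ := poly_bound (ε := ε / 2) (by positivity)
  refine ⟨4 * D * C, by positivity, fun k => ?_⟩
  have hk : (0 : ℝ) ≤ k := Nat.cast_nonneg _
  have h1 : ((k : ℝ) + 1) ^ e ≤ ((k : ℝ) + 2) ^ 2 := by
    calc ((k : ℝ) + 1) ^ e ≤ ((k : ℝ) + 1) ^ (2 : ℝ) :=
          Real.rpow_le_rpow_of_exponent_le (by linarith) he2
      _ = ((k : ℝ) + 1) ^ 2 := by norm_num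
      _ ≤ _ := by gcongr; norm_num
  have h2 : (((k : ℝ) + 1) * (2 : ℝ) ^ (-((k : ℝ) * L))) ^ e
      ≤ ((k : ℝ) + 2) ^ 2 * (2 : ℝ) ^ (-((k : ℝ) * (e * L))) := by
    rw [Real.mul_rpow (by positivity) (by positivity), ← Real.rpow_mul (by norm_num),
      show -((k : ℝ) * L) * e = -((k : ℝ) * (e * L)) by ring]
    gcongr
  have hQk := hQ k
  calc gau e L Q k ≤ 4 * (((k : ℝ) + 2) * ((k : ℝ) + 2)) *
        ((((k : ℝ) + 2) ^ 2 * (2 : ℝ) ^ (-((k : ℝ) * (e * L)))) *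
          (C * (2 : ℝ) ^ ((k : ℝ) * (l + ε / 2)))) := by
        unfold gau
        gcongr
        · norm_num
        · exact h k
    _ = 4 * ((k : ℝ) + 2) ^ 4 * C *
        ((2 : ℝ) ^ (-((k : ℝ) * (e * L))) * (2 : ℝ) ^ ((k : ℝ) * (l + ε / 2))) := by ring
    _ ≤ 4 * (D * (2 : ℝ) ^ ((k : ℝ) * (ε / 2))) * C *
        ((2 : ℝ) ^ (-((k : ℝ) * (e * L))) * (2 : ℝ) ^ ((k : ℝ) * (l + ε / 2))) := by
        gcongr; exact hd k
    _ = 4 * D * C * ((2 : ℝ) ^ ((k : ℝ) * (ε / 2)) *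
        ((2 : ℝ) ^ (-((k : ℝ) * (e * L))) * (2 : ℝ) ^ ((k : ℝ) * (l + ε / 2)))) := by ring
    _ = _ := by
        rw [← Real.rpow_add (by norm_num), ← Real.rpow_add (by norm_num)]
        congr 2
        ring

lemma gau_term {e L p w : ℝ} {Q : ℕ → ℝ} (hp : 0 < p) (hQ : ∀ k, 0 < Q k) (k : ℕ)
    (hw : w ≤ (((k : ℝ) + 1) * (2 : ℝ) ^ (-((k : ℝ) * L))) ^ e * Q k) :
    (gau e L Q k ^ (1 / p)) ^ (-p) * w ≤ 1 / (((k : ℝ) + 1) * ((k : ℝ) + 2)) / 4 := by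
  have hg := gau_pos (e := e) (L := L) hQ k
  rw [← Real.rpow_mul hg.le, show 1 / p * -p = -1 by field_simp, Real.rpow_neg_one]
  rw [inv_mul_le_iff₀ hg]
  have hQk := hQ k
  refine hw.trans (le_of_eq ?_)
  unfold gau
  field_simp

variable {ι κ : Type*} [Fintype ι] [Fintype κ] [DecidableEq ι] [DecidableEq κ]
variable {F : Set (Set ((ι → ℝ) × (κ → ℝ)))}

lemma core_pair (hF : ZoomFamily F) {q θ L : ℝ} (hq : 1 < q) (hθ : 0 < θ)
    (hrec : ∀ N : ℕ, ∃ n ≥ N, ∀ k ≤ n,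
      PP F q (n - k) ≤ ((k : ℝ) + 1) * (2 : ℝ) ^ (-((k : ℝ) * L)) * PP F q n) :
    ∀ N : ℕ, ∃ n ≥ N, ∃ Z ∈ F, ∃ Y : Finset (ι → ℤ),
      (∀ J : Finset (ℕ × (ι → ℤ)), (∀ j ∈ J, j.1 ≤ n) →
        (∀ u ∈ Y, ∃ j ∈ J, tr (n - j.1) u = j.2) →
        1 / 4 ≤ ∑ j ∈ J, gau (1 + θ) L (PP F (q * (1 + θ))) j.1 ^ (1 / θ)) ∧
      (∀ u ∈ Y, ∀ J : Finset (ℕ × (κ → ℤ)), (∀ j ∈ J, j.1 ≤ n) →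
        (∀ z ∈ Z, lab n z.1 = u → ∃ j ∈ J, lab j.1 z.2 = j.2) →
        1 / 4 ≤ ∑ j ∈ J, gau 1 L (PP F 1) j.1 ^ (1 / (q - 1))) := by
  intro N
  obtain ⟨n, hn, hrec⟩ := hrec N
  obtain ⟨Z, hZ, hmax⟩ := PP_attained hF q n
  have hq2 : 1 ≤ q * (1 + θ) := by nlinarith
  have hP0 : ∀ r : ℝ, 1 ≤ r → ∀ k, 0 < PP F r k := fun r hr k =>
    lt_of_lt_of_le one_pos (one_le_PP hF hr k)
  have hPn := hP0 q hq.le n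
  have hT : (hits n Z).Nonempty := by
    by_contra h
    rw [Finset.not_nonempty_iff_eq_empty] at h
    rw [h] at hmax
    simp only [Phi, Finset.sum_empty] at hmax
    linarith
  have him : ∀ k ≤ n, (hits n Z).image (Prod.map (tr (n - k)) (tr (n - k))) = hits k Z := by
    intro k hk
    have := hits_image hF hZ k (n - k)
    rwa [show k + (n - k) = n by omega] at this
  have hsum := sum_inv_le (n + 1)
  have key := finite_core hq hθ (hits n Z) hT n (fun k => tr (n - k))
    (fun k => tr (n - k)) (fun k => PP F q (n - k))
    (fun k => gau 1 L (PP F 1) k ^ (1 / (q - 1)))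
    (fun k => gau (1 + θ) L (PP F (q * (1 + θ))) k ^ (1 / θ))
    (fun k => Real.rpow_pos_of_pos (gau_pos (hP0 1 le_rfl) k) _)
    (fun k => Real.rpow_pos_of_pos (gau_pos (hP0 _ hq2) k) _)
    (fun k hk C => by
      have := cell_le hF hq.le hZ k (n - k) C
      rwa [show k + (n - k) = n by omega] at this) (by
    rw [hmax]
    calc _ ≤ ∑ k ∈ Finset.range (n + 1),
          1 / (((k : ℝ) + 1) * ((k : ℝ) + 2)) / 4 * PP F q n := by
          refine Finset.sum_le_sum fun k hk => ?_
          have hk : k ≤ n := by have := Finset.mem_range.1 hk; omega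
          rw [him k hk]
          have hcard : ((hits k Z).card : ℝ) ≤ PP F 1 k := by
            rw [← phi_one]; exact phi_le_PP hZ 1 k
          have hw : (hits k Z).card * PP F q (n - k) / PP F q n ≤
              (((k : ℝ) + 1) * (2 : ℝ) ^ (-((k : ℝ) * L))) ^ (1 : ℝ) * PP F 1 k := by
            rw [div_le_iff₀ hPn, Real.rpow_one]
            calc (hits k Z).card * PP F q (n - k) ≤ PP F 1 k *
                  (((k : ℝ) + 1) * (2 : ℝ) ^ (-((k : ℝ) * L)) * PP F q n) := by
                  gcongr
                  · exact (hP0 q hq.le _).le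
                  · exact (hP0 1 le_rfl _).le
                  · exact hrec k hk
              _ = _ := by ring
          have := gau_term (p := q - 1) (by linarith) (hP0 1 le_rfl) k hw
          rw [mul_div_assoc', div_le_iff₀ hPn] at this
          exact this
      _ = (∑ k ∈ Finset.range (n + 1),
          1 / (((k : ℝ) + 1) * ((k : ℝ) + 2))) * (PP F q n / 4) := by
          rw [Finset.sum_mul]
          exact Finset.sum_congr rfl fun k _ => by ring
      _ ≤ 1 * (PP F q n / 4) := by gcongr
      _ = _ := by ring) (by
    rw [hmax]
    calc _ ≤ ∑ k ∈ Finset.range (n + 1),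
          1 / (((k : ℝ) + 1) * ((k : ℝ) + 2)) / 4 := by
          refine Finset.sum_le_sum fun k hk => ?_
          have hk : k ≤ n := by have := Finset.mem_range.1 hk; omega
          rw [him k hk]
          refine gau_term hθ (hP0 _ hq2) k ?_
          have h1 : PP F q (n - k) / PP F q n ≤ ((k : ℝ) + 1) * (2 : ℝ) ^ (-((k : ℝ) * L)) := by
            rw [div_le_iff₀ hPn]; exact hrec k hk
          have h2 : 0 ≤ PP F q (n - k) / PP F q n := div_nonneg (hP0 q hq.le _).le hPn.le
          have h3 := phi_nonneg (q * (1 + θ)) (hits k Z)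
          have h4 := phi_le_PP hZ (q * (1 + θ)) k
          gcongr
      _ = (∑ k ∈ Finset.range (n + 1),
          1 / (((k : ℝ) + 1) * ((k : ℝ) + 2))) * (1 / 4) := by
          rw [Finset.sum_mul]
          exact Finset.sum_congr rfl fun k _ => by ring
      _ ≤ 1 * (1 / 4) := by gcongr
      _ = _ := by ring)
  obtain ⟨Y, hY1, hY2⟩ := key
  refine ⟨n, hn, Z, hZ, Y, hY1, fun u hu J hJ hc => hY2 u hu J hJ fun v hv => ?_⟩
  obtain ⟨z, hz, hzz⟩ := (mem_hits hF hZ).1 hv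
  simp only [Prod.mk.injEq] at hzz
  obtain ⟨j, hj, hjj⟩ := hc z hz hzz.1
  refine ⟨j, hj, ?_⟩
  rw [← hjj, ← hzz.2]
  have := tr_lab j.1 (n - j.1) z.2
  rwa [show j.1 + (n - j.1) = n by have := hJ j hj; omega] at this

theorem core (hF : ZoomFamily F) : ∃ δ Δ : ℝ, 0 ≤ δ ∧ 0 ≤ Δ ∧
    (∀ ε > 0, ∃ C : ℝ, 0 < C ∧ ∀ k : ℕ, ∀ Z ∈ F,
      ((hits k Z).card : ℝ) ≤ C * (2 : ℝ) ^ ((k : ℝ) * (δ + ε))) ∧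
    ∀ η > 0, ∃ t s : ℕ → ℝ, (∀ k, 0 < t k) ∧ (∀ k, 0 < s k) ∧
      (∀ ε > 0, ∃ C : ℝ, 0 < C ∧ ∀ k : ℕ, t k ≤ C * (2 : ℝ) ^ (-((k : ℝ) * (Δ - ε)))) ∧
      (∃ C : ℝ, 0 < C ∧ ∀ k : ℕ, s k ≤ C * (2 : ℝ) ^ (-((k : ℝ) * (δ - Δ - η)))) ∧
      ∀ N : ℕ, ∃ n ≥ N, ∃ Z ∈ F, ∃ Y : Finset (ι → ℤ),
      (∀ J : Finset (ℕ × (ι → ℤ)), (∀ j ∈ J, j.1 ≤ n) →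
        (∀ u ∈ Y, ∃ j ∈ J, tr (n - j.1) u = j.2) → 1 / 4 ≤ ∑ j ∈ J, s j.1) ∧
      (∀ u ∈ Y, ∀ J : Finset (ℕ × (κ → ℤ)), (∀ j ∈ J, j.1 ≤ n) →
        (∀ z ∈ Z, lab n z.1 = u → ∃ j ∈ J, lab j.1 z.2 = j.2) → 1 / 4 ≤ ∑ j ∈ J, t j.1) := by
  have hP0 : ∀ r : ℝ, 1 ≤ r → ∀ k, 0 < PP F r k := fun r hr k =>
    lt_of_lt_of_le one_pos (one_le_PP hF hr k)
  have hg : ∀ q : ℝ, ∃ L : ℝ, 1 ≤ q → 0 ≤ L ∧ (∀ n : ℕ, (2 : ℝ) ^ ((n : ℝ) * L) ≤ PP F q n) ∧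
      (∀ ε > 0, ∃ C : ℝ, 0 < C ∧ ∀ n : ℕ, PP F q n ≤ C * (2 : ℝ) ^ ((n : ℝ) * (L + ε))) ∧
      (∀ N : ℕ, ∃ n ≥ N, ∀ k ≤ n,
        PP F q (n - k) ≤ ((k : ℝ) + 1) * (2 : ℝ) ^ (-((k : ℝ) * L)) * PP F q n) := by
    intro q
    by_cases hq : 1 ≤ q
    · obtain ⟨L, h⟩ := growth (PP F q) (one_le_PP hF hq) (PP_submul hF hq)
      exact ⟨L, fun _ => h⟩
    · exact ⟨0, fun h => absurd h hq⟩
  choose L hL using hg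
  have hmono : ∀ q, 1 ≤ q → L 1 ≤ L q := by
    intro q hq
    refine le_of_forall_pos_le_add fun ε hε => ?_
    obtain ⟨C, hC, h⟩ := (hL q hq).2.2.1 ε hε
    refine exp_compare (C := C) fun n => ?_
    refine ((hL 1 le_rfl).2.1 n).trans (le_trans ?_ (h n))
    obtain ⟨Z, hZ, hmax⟩ := PP_attained hF 1 n
    rw [← hmax]
    exact (phi_mono_exp hq _).trans (phi_le_PP hZ q n)
  set S := (fun q => (L q - L 1) / (q - 1)) '' Ioc (1 : ℝ) 2 with hS
  have hSne : S.Nonempty := ⟨_, ⟨2, by norm_num, rfl⟩⟩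
  have hS0 : ∀ x ∈ S, 0 ≤ x := by
    rintro _ ⟨q, hq, rfl⟩
    exact div_nonneg (by linarith [hmono q hq.1.le]) (by linarith [hq.1])
  have hbdd : BddBelow S := ⟨0, hS0⟩
  refine ⟨L 1, sInf S, (hL 1 le_rfl).1, le_csInf hSne hS0, ?_, ?_⟩
  · intro ε hε
    obtain ⟨C, hC, h⟩ := (hL 1 le_rfl).2.2.1 ε hε
    refine ⟨C, hC, fun k Z hZ => ?_⟩
    rw [← phi_one]
    exact (phi_le_PP hZ 1 k).trans (h k)
  intro η hη
  obtain ⟨x, ⟨q', hq', rfl⟩, hx⟩ := exists_lt_of_csInf_lt hSne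
    (show sInf S < sInf S + η / 4 by linarith)
  set Δ := sInf S
  obtain ⟨hq1, hq2⟩ := hq'
  set q := (1 + q') / 2 with hqdef
  set θ := (q - 1) / q with hθdef
  have hq : 1 < q := by linarith
  have hqle : q ≤ 3 / 2 := by linarith
  have hθ : 0 < θ := div_pos (by linarith) (by linarith)
  have hθ1 : θ ≤ 1 := by rw [hθdef, div_le_one (by linarith)]; linarith
  have hqq : q * (1 + θ) = q' := by
    rw [hθdef]; field_simp; rw [hqdef]; ring
  have hΔq : Δ ≤ (L q - L 1) / (q - 1) := csInf_le hbdd ⟨q, ⟨hq, by linarith⟩, rfl⟩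
  simp only at hx
  refine ⟨fun k => gau 1 (L q) (PP F 1) k ^ (1 / (q - 1)),
    fun k => gau (1 + θ) (L q) (PP F (q * (1 + θ))) k ^ (1 / θ),
    fun k => Real.rpow_pos_of_pos (gau_pos (hP0 1 le_rfl) k) _,
    fun k => Real.rpow_pos_of_pos (gau_pos (hP0 _ (by rw [hqq]; exact hq1.le)) k) _, ?_, ?_,
    core_pair hF hq hθ (hL q hq.le).2.2.2⟩
  · intro ε hε
    obtain ⟨C, hC, h⟩ := gauge_rpow (p := q - 1) (by linarith) _ (gau_pos (hP0 1 le_rfl))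
      (gau_bound (e := 1) (L := L q) (by norm_num) (hP0 1 le_rfl) (hL 1 le_rfl).2.2.1) ε hε
    refine ⟨C, hC, fun k => (h k).trans ?_⟩
    gcongr
    · norm_num
    · rw [one_mul]; exact hΔq
  · rw [hqq]
    obtain ⟨C, hC, h⟩ := gauge_rpow hθ _ (gau_pos (hP0 q' hq1.le))
      (gau_bound (e := 1 + θ) (L := L q) (by linarith) (hP0 q' hq1.le)
        (hL q' hq1.le).2.2.1) (η / 4) (by positivity)
    refine ⟨C, hC, fun k => (h k).trans ?_⟩
    gcongr C * 2 ^ (-((k : ℝ) * ?_))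
    · norm_num
    · have a1 : Δ * (q - 1) ≤ L q - L 1 := by rwa [le_div_iff₀ (by linarith)] at hΔq
      have a2 : L q' - L 1 < (Δ + η / 4) * (q' - 1) := by rwa [div_lt_iff₀ (by linarith)] at hx
      have a3 : (L 1 - Δ - 3 * (η / 4)) ≤ ((1 + θ) * L q - L q') / θ := by
        rw [le_div_iff₀ hθ]
        have e1 : q' - 1 = 2 * (q - 1) := by rw [hqdef]; ring
        have e2 : q - 1 = θ * q := by rw [hθdef]; field_simp
        rw [e1, e2] at a2
        rw [e2] at a1
        have a4 : L q * (1 + θ) ≥ (L 1 + Δ * (θ * q)) * (1 + θ) := by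
          have : L q ≥ L 1 + Δ * (θ * q) := by linarith
          gcongr
        have e3 : Δ * (θ * q) * (1 + θ) = Δ * θ * (q * (1 + θ)) := by ring
        have e4 : q * (1 + θ) = 2 * q - 1 := by rw [hqq, hqdef]; ring
        have a5 : (η / 4) * (2 * (θ * q)) ≤ 3 * (η / 4) * θ := by
          have : θ * q ≤ θ * (3 / 2) := by gcongr
          nlinarith
        rw [e4] at e3
        nlinarith
      linarith

end Core

section MassDistribution

variable {σ : Type*} [Fintype σ] [DecidableEq σ]

/-- the labels of level `k` close to the label of `x` -/
def nbl (k : ℕ) (x : EuclideanSpace ℝ σ) : Finset (σ → ℤ) :=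
  Fintype.piFinset fun j => Finset.Icc (lab k x.ofLp j - 1) (lab k x.ofLp j + 1)

lemma nbl_card (k : ℕ) (x : EuclideanSpace ℝ σ) : (nbl k x).card = 3 ^ Fintype.card σ := by
  unfold nbl
  rw [Fintype.card_piFinset]
  have : ∀ j, (Finset.Icc (lab k x.ofLp j - 1) (lab k x.ofLp j + 1)).card = 3 := by
    intro j
    rw [Int.card_Icc]
    have : lab k x.ofLp j + 1 + 1 - (lab k x.ofLp j - 1) = 3 := by ring
    rw [this]; rfl
  simp only [this, Finset.prod_const, Finset.card_univ]

lemma lab_mem_nbl {k : ℕ} {x y : EuclideanSpace ℝ σ} (h : dist y x ≤ (1 / 2 : ℝ) ^ k) :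
    lab k y.ofLp ∈ nbl k x := by
  simp only [nbl, Fintype.mem_piFinset, Finset.mem_Icc, lab]
  intro j
  have h1 := (PiLp.dist_apply_le y x j).trans h
  rw [Real.dist_eq] at h1
  have hp : (0 : ℝ) < 2 ^ k := by positivity
  have h2 : (2 : ℝ) ^ k * (1 / 2 : ℝ) ^ k = 1 := by rw [← mul_pow]; norm_num
  have h3 : |(2 : ℝ) ^ k * y.ofLp j - 2 ^ k * x.ofLp j| ≤ 1 := by
    rw [← mul_sub, abs_mul, abs_of_pos hp, ← h2]
    gcongr
  rw [abs_le] at h3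
  constructor
  · rw [Int.le_floor]
    push_cast
    have := Int.floor_le ((2 : ℝ) ^ k * x.ofLp j)
    linarith
  · rw [← Int.floor_add_one]
    apply Int.floor_mono
    linarith

lemma mass_dist (A : Set (EuclideanSpace ℝ σ)) (hA : IsCompact A) {d C : ℝ} (hd : 0 < d)
    (hC : 0 < C) (t : ℕ → ℝ) (ht0 : ∀ k, 0 < t k)
    (ht : ∀ k : ℕ, t k ≤ C * (2 : ℝ) ^ (-((k : ℝ) * d)))
    (h : ∀ U, IsOpen U → A ⊆ U → ∀ N : ℕ, ∃ n ≥ N, ∃ D ⊆ U, ∀ J : Finset (ℕ × (σ → ℤ)),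
      (∀ j ∈ J, j.1 ≤ n) → (∀ x ∈ D, ∃ j ∈ J, lab j.1 x.ofLp = j.2) → 1 / 4 ≤ ∑ j ∈ J, t j.1) :
    ENNReal.ofReal d ≤ dimH A := by
  by_contra hlt
  push Not at hlt
  have hmu : μH[d] A = 0 := by
    have := hausdorffMeasure_of_dimH_lt (s := A) (d := d.toNNReal) hlt
    rwa [Real.coe_toNNReal d hd.le] at this
  set c : ℝ := 3 ^ Fintype.card σ * C * 2 ^ d with hc
  have hc0 : 0 < c := by positivity
  set ε : ℝ := 1 / (16 * c) with hε
  have hε0 : 0 < ε := by positivity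
  rw [Measure.hausdorffMeasure_apply] at hmu
  have h1 : (⨅ (T : ℕ → Set (EuclideanSpace ℝ σ)) (_ : A ⊆ ⋃ n, T n)
      (_ : ∀ n, ediam (T n) ≤ ENNReal.ofReal (1 / 2)),
      ∑' n, ⨆ (_ : (T n).Nonempty), ediam (T n) ^ d) = 0 := by
    rw [ENNReal.iSup_eq_zero] at hmu
    have := hmu (ENNReal.ofReal (1 / 2))
    rw [ENNReal.iSup_eq_zero] at this
    exact this (by simp)
  have h2 := h1.trans_lt (ENNReal.ofReal_pos.2 hε0)
  simp only [iInf_lt_iff] at h2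
  obtain ⟨T, hT1, hT2, hT3⟩ := h2
  have hfin : ∀ i, ediam (T i) ≠ ⊤ := fun i => ne_top_of_le_ne_top ENNReal.ofReal_ne_top (hT2 i)
  have hD : ∀ i, diam (T i) ≤ 1 / 2 := fun i => by
    have := ENNReal.toReal_mono ENNReal.ofReal_ne_top (hT2 i)
    rwa [ENNReal.toReal_ofReal (by norm_num)] at this
  have hρ : ∀ i : ℕ, ∃ ρ : ℝ, diam (T i) < ρ ∧ ρ ≤ 1 ∧ ρ ^ d < diam (T i) ^ d + ε / 2 / 2 ^ i := by
    intro i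
    have hcont : ContinuousAt (fun x : ℝ => x ^ d) (diam (T i)) :=
      Real.continuousAt_rpow_const _ _ (Or.inr hd.le)
    have e1 : ∀ᶠ ρ in 𝓝[>] diam (T i), ρ ^ d < diam (T i) ^ d + ε / 2 / 2 ^ i :=
      (hcont.eventually_lt_const (by
        have : 0 < ε / 2 / 2 ^ i := by positivity
        linarith)).filter_mono nhdsWithin_le_nhds
    have e2 : ∀ᶠ ρ in 𝓝[>] diam (T i), ρ < 1 :=
      (eventually_lt_nhds (by have := hD i; linarith)).filter_mono nhdsWithin_le_nhds
    obtain ⟨ρ, r1, r2, r3⟩ := (e1.and (e2.and self_mem_nhdsWithin)).exists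
    exact ⟨ρ, r3, r2.le, r1⟩
  choose ρ hρ1 hρ2 hρ3 using hρ
  have hρ0 : ∀ i, 0 < ρ i := fun i => lt_of_le_of_lt diam_nonneg (hρ1 i)
  have hk : ∀ i, ∃ k : ℕ, (1 / 2 : ℝ) ^ (k + 1) < ρ i ∧ ρ i ≤ (1 / 2 : ℝ) ^ k := fun i =>
    exists_nat_pow_near_of_lt_one (hρ0 i) (hρ2 i) (by norm_num) (by norm_num)
  choose k hk1 hk2 using hk
  let I' := {i : ℕ // (T i).Nonempty}
  have hx : ∀ i : I', ∃ x, x ∈ T i.1 := fun i => i.2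
  choose x hx using hx
  obtain ⟨I, hI⟩ := hA.elim_finite_subcover (fun i : I' => ball (x i) (ρ i.1))
    (fun i => isOpen_ball) (by
      intro y hy
      obtain ⟨i, hi⟩ := mem_iUnion.1 (hT1 hy)
      refine mem_iUnion.2 ⟨⟨i, ⟨y, hi⟩⟩, ?_⟩
      rw [mem_ball]
      refine lt_of_le_of_lt (dist_le_diam_of_mem' (hfin i) hi (hx ⟨i, ⟨y, hi⟩⟩)) (hρ1 i))
  obtain ⟨n, hn, D, hDU, hJ⟩ := h (⋃ i ∈ I, ball (x i) (ρ i.1))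
    (isOpen_biUnion fun i _ => isOpen_ball) hI (I.sup fun i => k i.1)
  classical
  have h4 := hJ (I.biUnion fun i => (nbl (k i.1) (x i)).image fun v => (k i.1, v)) ?_ ?_
  · have h5 := sum_biUnion_le' I (fun i => (nbl (k i.1) (x i)).image fun v => (k i.1, v))
      (fun j => t j.1) (fun j => (ht0 _).le)
    have h6 : ∀ i ∈ I, ∑ j ∈ (nbl (k i.1) (x i)).image (fun v => (k i.1, v)), t j.1
        ≤ c * (diam (T i.1) ^ d + ε / 2 / 2 ^ i.1) := by
      intro i _
      rw [Finset.sum_image (fun a _ b _ hab => (Prod.mk.inj hab).2)]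
      simp only [Finset.sum_const, nbl_card, nsmul_eq_mul]
      push_cast
      have hpow : (2 : ℝ) ^ (-((k i.1 : ℝ) * d)) ≤ 2 ^ d * ρ i.1 ^ d := by
        rw [← Real.mul_rpow (by norm_num) (hρ0 _).le]
        have : (2 : ℝ) ^ (-((k i.1 : ℝ) * d)) = ((1 / 2 : ℝ) ^ (k i.1)) ^ d := by
          rw [one_div, ← Real.rpow_natCast, Real.inv_rpow (by norm_num), ← Real.rpow_neg (by norm_num),
            ← Real.rpow_mul (by norm_num)]
          congr 1; ring
        rw [this]
        refine Real.rpow_le_rpow (by positivity) ?_ hd.le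
        have := (hk1 i.1).le
        rw [pow_succ] at this
        linarith
      calc (3 : ℝ) ^ Fintype.card σ * t (k i.1)
          ≤ 3 ^ Fintype.card σ * (C * (2 ^ d * ρ i.1 ^ d)) := by
            gcongr
            refine (ht _).trans ?_
            gcongr
        _ = c * ρ i.1 ^ d := by rw [hc]; ring
        _ ≤ _ := by gcongr; exact (hρ3 _).le
    have h7 : ∑ i ∈ I, c * (diam (T i.1) ^ d + ε / 2 / 2 ^ i.1) ≤ c * (ε + ε) := by
      rw [← Finset.mul_sum, Finset.sum_add_distrib]
      gcongr
      · rw [← ENNReal.ofReal_le_ofReal_iff hε0.le, ENNReal.ofReal_sum_of_nonneg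
          (fun i _ => Real.rpow_nonneg diam_nonneg _)]
        refine le_trans ?_ hT3.le
        calc ∑ i ∈ I, ENNReal.ofReal (diam (T i.1) ^ d)
            = ∑ i ∈ I, ⨆ (_ : (T i.1).Nonempty), ediam (T i.1) ^ d := by
              refine Finset.sum_congr rfl fun i _ => ?_
              rw [iSup_pos i.2, ← ENNReal.ofReal_rpow_of_nonneg diam_nonneg hd.le, diam,
                ENNReal.ofReal_toReal (hfin _)]
          _ = ∑ i ∈ I.map (Function.Embedding.subtype _),
                ⨆ (_ : (T i).Nonempty), ediam (T i) ^ d := by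
              rw [Finset.sum_map]; rfl
          _ ≤ _ := ENNReal.sum_le_tsum _
      · calc ∑ i ∈ I, ε / 2 / 2 ^ i.1
            = ∑ i ∈ I.map (Function.Embedding.subtype _), ε / 2 / 2 ^ i := by
              rw [Finset.sum_map]; rfl
          _ ≤ ε := sum_le_hasSum _ (fun i _ => by positivity) (hasSum_geometric_two' ε)
    have h8 : c * (ε + ε) = 1 / 8 := by rw [hε]; field_simp; norm_num
    have := h4.trans (h5.trans ((Finset.sum_le_sum h6).trans h7))
    rw [h8] at this
    norm_num at this
  · intro j hj
    simp only [Finset.mem_biUnion, Finset.mem_image] at hj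
    obtain ⟨i, hi, v, _, rfl⟩ := hj
    exact le_trans (Finset.le_sup (f := fun i : I' => k i.1) hi) hn
  · intro y hy
    have := hDU hy
    simp only [mem_iUnion] at this
    obtain ⟨i, hi, hb⟩ := this
    refine ⟨(k i.1, lab (k i.1) y.ofLp), ?_, rfl⟩
    simp only [Finset.mem_biUnion, Finset.mem_image]
    exact ⟨i, hi, _, lab_mem_nbl ((mem_ball.1 hb).le.trans (hk2 _)), rfl⟩

lemma lab_dist {k : ℕ} {x y : EuclideanSpace ℝ σ} (h : lab k x.ofLp = lab k y.ofLp) :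
    dist x y ≤ √(Fintype.card σ) * (1 / 2 : ℝ) ^ k := by
  rw [EuclideanSpace.dist_eq]
  have h1 : ∀ j, dist (x.ofLp j) (y.ofLp j) ≤ (1 / 2 : ℝ) ^ k := by
    intro j
    have h2 := congrFun h j
    simp only [lab] at h2
    have h3 := Int.abs_sub_lt_one_of_floor_eq_floor h2
    have hp : (0 : ℝ) < 2 ^ k := by positivity
    rw [← mul_sub, abs_mul, abs_of_pos hp] at h3
    rw [Real.dist_eq, one_div, inv_pow, ← one_div, le_div_iff₀ hp]
    linarith
  calc √(∑ j, dist (x.ofLp j) (y.ofLp j) ^ 2) ≤ √(∑ j : σ, ((1 / 2 : ℝ) ^ k) ^ 2) := by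
        gcongr with j
        exact h1 j
    _ = _ := by
        rw [Finset.sum_const, Finset.card_univ, nsmul_eq_mul, Real.sqrt_mul (by positivity),
          Real.sqrt_sq (by positivity)]

lemma dimH_le_of_cover (A : Set (EuclideanSpace ℝ σ)) {δ : ℝ} (hδ : 0 ≤ δ)
    (h : ∀ ε > 0, ∃ C : ℝ, 0 < C ∧ ∀ k : ℕ, ∃ S : Finset (σ → ℤ),
      (∀ x ∈ A, lab k x.ofLp ∈ S) ∧ (S.card : ℝ) ≤ C * (2 : ℝ) ^ ((k : ℝ) * (δ + ε))) :
    dimH A ≤ ENNReal.ofReal δ := by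
  refine ENNReal.le_of_forall_pos_le_add fun ε hε _ => ?_
  have hε' : (0 : ℝ) < ε := hε
  obtain ⟨C, hC, h⟩ := h ε hε'
  choose S hS1 hS2 using h
  set c : ℝ := √(Fintype.card σ) with hc
  set d : ℝ≥0 := δ.toNNReal + ε with hd
  have hdr : (d : ℝ) = δ + ε := by rw [hd, NNReal.coe_add, Real.coe_toNNReal _ hδ]
  have hd0 : (0 : ℝ) < d := by rw [hdr]; linarith
  have hgoal : ENNReal.ofReal δ + ε = (d : ℝ≥0∞) := by
    rw [hd, ENNReal.coe_add]
    rfl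
  rw [hgoal]
  refine dimH_le_of_hausdorffMeasure_ne_top (d := d) ?_
  have key := Measure.hausdorffMeasure_le_liminf_sum (d : ℝ) A (l := atTop)
    (fun k : ℕ => ENNReal.ofReal (c * (1 / 2 : ℝ) ^ k)) (by
      have : Tendsto (fun k : ℕ => c * (1 / 2 : ℝ) ^ k) atTop (𝓝 (c * 0)) :=
        (tendsto_pow_atTop_nhds_zero_of_lt_one (by norm_num) (by norm_num)).const_mul c
      rw [mul_zero] at this
      have := ENNReal.tendsto_ofReal this
      rwa [ENNReal.ofReal_zero] at this)
    (fun k (v : S k) => {x ∈ A | lab k x.ofLp = v.1})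
    (Eventually.of_forall fun k v => by
      refine ediam_le fun x hx y hy => ?_
      rw [edist_dist]
      exact ENNReal.ofReal_le_ofReal (lab_dist (hx.2.trans hy.2.symm)))
    (Eventually.of_forall fun k x hx => mem_iUnion.2 ⟨⟨_, hS1 k x hx⟩, hx, rfl⟩)
  refine ne_top_of_le_ne_top (b := ENNReal.ofReal (C * c ^ (d : ℝ))) ENNReal.ofReal_ne_top (key.trans ?_)
  refine liminf_le_of_le ⟨0, by simp⟩ fun b hb => ?_
  obtain ⟨k, hk⟩ := hb.exists
  refine hk.trans ?_
  calc ∑ v : S k, ediam {x ∈ A | lab k x.ofLp = v.1} ^ (d : ℝ)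
      ≤ ∑ v : S k, ENNReal.ofReal ((c * (1 / 2 : ℝ) ^ k) ^ (d : ℝ)) := by
        refine Finset.sum_le_sum fun v _ => ?_
        rw [← ENNReal.ofReal_rpow_of_nonneg (by positivity) hd0.le]
        gcongr
        refine ediam_le fun x hx y hy => ?_
        rw [edist_dist]
        exact ENNReal.ofReal_le_ofReal (lab_dist (hx.2.trans hy.2.symm))
    _ = ENNReal.ofReal ((S k).card * (c * (1 / 2 : ℝ) ^ k) ^ (d : ℝ)) := by
        rw [Finset.sum_const, Finset.card_univ, Fintype.card_coe, nsmul_eq_mul,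
          ENNReal.ofReal_mul (by positivity), ENNReal.ofReal_natCast]
    _ ≤ _ := by
        apply ENNReal.ofReal_le_ofReal
        calc (S k).card * (c * (1 / 2 : ℝ) ^ k) ^ (d : ℝ)
            ≤ (C * (2 : ℝ) ^ ((k : ℝ) * (δ + ε))) * (c * (1 / 2 : ℝ) ^ k) ^ (d : ℝ) := by
              gcongr; exact hS2 k
          _ = C * c ^ (d : ℝ) := by
              rw [Real.mul_rpow (by positivity) (by positivity), ← Real.rpow_natCast (1 / 2 : ℝ) k,
                ← Real.rpow_mul (by norm_num), one_div, Real.inv_rpow (by norm_num), hdr]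
              have : (0 : ℝ) < (2 : ℝ) ^ ((k : ℝ) * (δ + ε)) := by positivity
              field_simp

end MassDistribution

section Limits

lemma blaschke {E : Type*} [MetricSpace E] {B : Set E} (hB : IsCompact B) (S : ℕ → Set E)
    (hc : ∀ i, IsClosed (S i)) (hne : ∀ i, (S i).Nonempty) (hsub : ∀ i, S i ⊆ B) :
    ∃ M : Set E, IsClosed M ∧ M.Nonempty ∧ M ⊆ B ∧ ∃ φ : ℕ → ℕ, StrictMono φ ∧
      Tendsto (fun i => hausdorffDist (S (φ i)) M) atTop (𝓝 0) := by
  have : CompactSpace B := isCompact_iff_compactSpace.1 hB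
  let T : ℕ → TopologicalSpace.NonemptyCompacts B := fun i =>
    { carrier := Subtype.val ⁻¹' S i
      isCompact' := ((hc i).preimage continuous_subtype_val).isCompact
      nonempty' := by
        obtain ⟨x, hx⟩ := hne i
        exact ⟨⟨x, hsub i hx⟩, hx⟩ }
  have hT : ∀ i, Subtype.val '' (T i : Set B) = S i := by
    intro i
    change Subtype.val '' (Subtype.val ⁻¹' S i) = S i
    rw [Subtype.image_preimage_coe, inter_eq_right.2 (hsub i)]
  obtain ⟨A, φ, hφ, hlim⟩ := CompactSpace.tendsto_subseq T
  refine ⟨Subtype.val '' (A : Set B), (A.isCompact.image continuous_subtype_val).isClosed,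
    A.nonempty.image _, by rintro _ ⟨x, _, rfl⟩; exact x.2, φ, hφ, ?_⟩
  rw [tendsto_iff_dist_tendsto_zero] at hlim
  refine hlim.congr fun i => ?_
  rw [Metric.NonemptyCompacts.dist_eq, ← hT, hausdorffDist_image isometry_subtype_coe]
  rfl

lemma unitCube_isCompact (n : ℕ) : IsCompact (unitCube n) := by
  have h1 : IsCompact (Set.pi univ fun _ : Fin n => Icc (0 : ℝ) 1) :=
    isCompact_univ_pi fun _ => isCompact_Icc
  have h2 := h1.image (PiLp.continuous_toLp 2 (fun _ : Fin n => ℝ))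
  convert h2 using 1
  ext x
  constructor
  · intro hx
    exact ⟨x.ofLp, fun i _ => hx i, rfl⟩
  · rintro ⟨y, hy, rfl⟩ i
    exact hy i (mem_univ i)

lemma tendsto_mem_limit {E : Type*} [MetricSpace E] {B M : Set E} (hB : IsCompact B)
    {S : ℕ → Set E} (hne : ∀ i, (S i).Nonempty) (hsub : ∀ i, S i ⊆ B)
    (hM : IsClosed M) (hMn : M.Nonempty) (hMB : M ⊆ B)
    (hlim : Tendsto (fun i => hausdorffDist (S i) M) atTop (𝓝 0))
    {x : ℕ → E} (hx : ∀ i, x i ∈ S i) {ψ : ℕ → ℕ} (hψ : StrictMono ψ) {y : E}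
    (hy : Tendsto (x ∘ ψ) atTop (𝓝 y)) : y ∈ M := by
  rw [hM.mem_iff_infDist_zero hMn]
  have h1 : Tendsto (fun i => infDist ((x ∘ ψ) i) M) atTop (𝓝 (infDist y M)) :=
    ((continuous_infDist_pt M).tendsto y).comp hy
  refine tendsto_nhds_unique h1 ?_
  refine squeeze_zero (fun i => infDist_nonneg) (fun i => ?_) (hlim.comp hψ.tendsto_atTop)
  exact infDist_le_hausdorffDist_of_mem (hx _)
    (hausdorffEDist_ne_top_of_nonempty_of_bounded (hne _) hMn (hB.isBounded.subset (hsub _))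
      (hB.isBounded.subset hMB))

lemma approx_limit {E : Type*} [MetricSpace E] {B M : Set E} (hB : IsCompact B)
    {S : ℕ → Set E} (hne : ∀ i, (S i).Nonempty) (hsub : ∀ i, S i ⊆ B)
    (hMB : M ⊆ B)
    (hlim : Tendsto (fun i => hausdorffDist (S i) M) atTop (𝓝 0)) {y : E} (hy : y ∈ M) :
    ∃ x : ℕ → E, (∀ i, x i ∈ S i) ∧ Tendsto x atTop (𝓝 y) := by
  have h1 : ∀ i, ∃ p ∈ S i, dist p y < hausdorffDist (S i) M + 1 / ((i : ℝ) + 1) := by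
    intro i
    refine exists_dist_lt_of_hausdorffDist_lt' hy ?_ ?_
    · have : (0 : ℝ) < 1 / ((i : ℝ) + 1) := by positivity
      linarith
    · exact hausdorffEDist_ne_top_of_nonempty_of_bounded (hne _) ⟨y, hy⟩
        (hB.isBounded.subset (hsub _)) (hB.isBounded.subset hMB)
  choose x hx1 hx2 using h1
  refine ⟨x, hx1, ?_⟩
  rw [tendsto_iff_dist_tendsto_zero]
  have h3 := hlim.add (tendsto_one_div_add_atTop_nhds_zero_nat (𝕜 := ℝ))
  rw [add_zero] at h3
  exact squeeze_zero (fun i => dist_nonneg) (fun i => (hx2 i).le) h3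

lemma eventually_subset {E : Type*} [MetricSpace E] {B M : Set E} (hB : IsCompact B)
    {S : ℕ → Set E} (hne : ∀ i, (S i).Nonempty) (hsub : ∀ i, S i ⊆ B)
    (hM : IsClosed M) (hMn : M.Nonempty) (hMB : M ⊆ B)
    (hlim : Tendsto (fun i => hausdorffDist (S i) M) atTop (𝓝 0))
    {U : Set E} (hU : IsOpen U) (hMU : M ⊆ U) : ∀ᶠ i in atTop, S i ⊆ U := by
  obtain ⟨δ, hδ, hth⟩ := (hB.of_isClosed_subset hM hMB).exists_thickening_subset_open hU hMU
  filter_upwards [hlim.eventually_lt_const hδ] with i hi x hx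
  obtain ⟨y, hy, hxy⟩ := exists_dist_lt_of_hausdorffDist_lt hx hi
    (hausdorffEDist_ne_top_of_nonempty_of_bounded (hne _) hMn (hB.isBounded.subset (hsub _))
      (hB.isBounded.subset hMB))
  exact hth (mem_thickening_iff.2 ⟨y, hy, hxy⟩)

lemma ofReal_le_of_forall {D : ℝ} {x : ℝ≥0∞} (h : ∀ d, 0 < d → d < D → ENNReal.ofReal d ≤ x) :
    ENNReal.ofReal D ≤ x := by
  refine le_of_forall_lt_imp_le_of_dense fun c hc => ?_
  have hc' : c ≠ ⊤ := ne_top_of_lt hc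
  rw [← ENNReal.ofReal_toReal hc'] at hc ⊢
  rcases eq_or_lt_of_le (ENNReal.toReal_nonneg (a := c)) with h0 | h0
  · rw [← h0]; simp
  · exact h _ h0 ((ENNReal.ofReal_lt_ofReal_iff_of_nonneg h0.le).1 hc)

/-- rescaled label point -/
def lpt {m : ℕ} (n : ℕ) (u : Fin m → ℤ) : EuclideanSpace ℝ (Fin m) :=
  WithLp.toLp 2 fun i => (u i : ℝ) / 2 ^ n

lemma lab_lpt {m : ℕ} (n : ℕ) (u : Fin m → ℤ) : lab n (lpt n u).ofLp = u := by
  funext i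
  simp only [lab, lpt]
  rw [mul_div_cancel₀ _ (by positivity), Int.floor_intCast]

lemma lab_lpt_le {m : ℕ} {n k : ℕ} (hk : k ≤ n) (u : Fin m → ℤ) :
    lab k (lpt n u).ofLp = tr (n - k) u := by
  have := tr_lab k (n - k) (lpt n u).ofLp
  rw [show k + (n - k) = n by omega, lab_lpt] at this
  exact this.symm

lemma lpt_mem {m : ℕ} {n : ℕ} {u : Fin m → ℤ} {z : Fin m → ℝ} (hz : lab 0 z = 0)
    (hu : lab n z = u) : lpt n u ∈ unitCube m := by
  intro i
  have := lab_mem_lbox hz n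
  rw [hu] at this
  simp only [lbox, Fintype.mem_piFinset, Finset.mem_Ico] at this
  have h := this i
  have hp : (0 : ℝ) < 2 ^ n := by positivity
  simp only [lpt, mem_Icc]
  constructor
  · have : (0 : ℝ) ≤ u i := by exact_mod_cast h.1
    positivity
  · rw [div_le_one hp]
    have := h.2.le
    exact_mod_cast this

lemma mem_unitCube_of_lab {m : ℕ} {x : EuclideanSpace ℝ (Fin m)} (h : lab 0 x.ofLp = 0) :
    x ∈ unitCube m := by
  rw [lab_zero_iff] at h
  exact fun i => ⟨(h i).1, (h i).2.le⟩

end Limits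

section Family

variable {n m : ℕ} (K : Set (EuclideanSpace ℝ (Fin n)))
  (f : EuclideanSpace ℝ (Fin n) →ₗ[ℝ] EuclideanSpace ℝ (Fin m))

/-- rescaled graph of `f` over `K` -/
def zset (r : ℝ) (e1 : EuclideanSpace ℝ (Fin m)) (e2 : EuclideanSpace ℝ (Fin n)) :
    Set ((Fin m → ℝ) × (Fin n → ℝ)) :=
  {z | (∃ x ∈ K, z = ((r • f x + e1).ofLp, (r • x + e2).ofLp)) ∧ lab 0 z.1 = 0 ∧ lab 0 z.2 = 0}

/-- subsets of rescaled graphs -/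
def zfam : Set (Set ((Fin m → ℝ) × (Fin n → ℝ))) :=
  {Z | ∃ r e1 e2, 1 ≤ r ∧ Z ⊆ zset K f r e1 e2}

lemma zfam_zoom (hK : K.Nonempty) : ZoomFamily (zfam K f) where
  unit := by
    rintro Z ⟨r, e1, e2, _, hZ⟩ z hz
    exact (hZ hz).2
  zoom := by
    rintro Z ⟨r, e1, e2, hr, hZ⟩ k C
    refine ⟨2 ^ k * r, (2 : ℝ) ^ k • e1 - WithLp.toLp 2 (fun i => (C.1 i : ℝ)),
      (2 : ℝ) ^ k • e2 - WithLp.toLp 2 (fun i => (C.2 i : ℝ)), ?_, ?_⟩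
    · have : (1 : ℝ) ≤ 2 ^ k := one_le_pow₀ (by norm_num)
      nlinarith
    · rintro _ ⟨z, hz, h1, h2, rfl⟩
      obtain ⟨⟨x, hx, hzx⟩, _, _⟩ := hZ hz
      refine ⟨⟨x, hx, ?_⟩, ?_, ?_⟩
      · rw [hzx]
        ext i
        · simp; ring
        · simp; ring
      · simp only [lab_zoom, add_zero, h1]
        funext i; simp
      · simp only [lab_zoom, add_zero, h2]
        funext i; simp
  nonempty := by
    obtain ⟨x, hx⟩ := hK
    refine ⟨zset K f 1 (-f x) (-x), ⟨1, _, _, le_rfl, Subset.rfl⟩, (0, 0), ⟨x, hx, ?_⟩, ?_, ?_⟩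
    · simp
    · rw [lab_zero_iff]; simp
    · rw [lab_zero_iff]; simp

lemma dim_upper (hK : K.Nonempty) {δ : ℝ} (hδ : 0 ≤ δ)
    (h : ∀ ε > 0, ∃ C : ℝ, 0 < C ∧ ∀ k : ℕ, ∀ Z ∈ zfam K f,
      ((hits k Z).card : ℝ) ≤ C * (2 : ℝ) ^ ((k : ℝ) * (δ + ε))) :
    dimH K ≤ ENNReal.ofReal δ := by
  let Kw : (Fin m → ℤ) × (Fin n → ℤ) → Set (EuclideanSpace ℝ (Fin n)) := fun w =>
    {x ∈ K | lab 0 (f x).ofLp = w.1 ∧ lab 0 x.ofLp = w.2}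
  have hKw : K ⊆ ⋃ w, Kw w := fun x hx =>
    mem_iUnion.2 ⟨(lab 0 (f x).ofLp, lab 0 x.ofLp), hx, rfl, rfl⟩
  refine (dimH_mono hKw).trans ?_
  rw [dimH_iUnion]
  refine iSup_le fun w => dimH_le_of_cover _ hδ fun ε hε => ?_
  obtain ⟨C, hC, h⟩ := h ε hε
  refine ⟨C, hC, fun k => ?_⟩
  let Z := zset K f 1 (-WithLp.toLp 2 (fun i => (w.1 i : ℝ))) (-WithLp.toLp 2 (fun i => (w.2 i : ℝ)))
  have hZ : Z ∈ zfam K f := ⟨1, _, _, le_rfl, Subset.rfl⟩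
  have hF := zfam_zoom K f hK
  refine ⟨(hits k Z).image fun p i => p.2 i + 2 ^ k * w.2 i, ?_, ?_⟩
  · rintro x ⟨hx, h1, h2⟩
    have e1 := lab_zoom 0 0 (f x).ofLp w.1
    have e2 := lab_zoom 0 0 x.ofLp w.2
    have e3 := lab_zoom 0 k x.ofLp w.2
    have e4 := lab_zoom 0 k (f x).ofLp w.1
    refine Finset.mem_image.2 ⟨(fun i => lab k (f x).ofLp i - 2 ^ k * w.1 i,
      fun i => lab k x.ofLp i - 2 ^ k * w.2 i), (mem_hits hF hZ).2 ⟨_, ⟨⟨x, hx, rfl⟩, ?_, ?_⟩, ?_⟩, ?_⟩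
    · refine Eq.trans ?_ (e1.trans ?_)
      · congr 1
      · rw [add_zero, h1]; simp; rfl
    · refine Eq.trans ?_ (e2.trans ?_)
      · congr 1
      · rw [add_zero, h2]; simp; rfl
    · rw [zero_add] at e3 e4
      rw [← e3, ← e4]
      congr 2
    · funext i; simp
  · refine le_trans ?_ (h k Z hZ)
    exact_mod_cast Finset.card_image_le

end Family

section Final

variable {n m : ℕ} (K : Set (EuclideanSpace ℝ (Fin n)))
  (f : EuclideanSpace ℝ (Fin n) →ₗ[ℝ] EuclideanSpace ℝ (Fin m))

/-- a rescaled piece of `K` -/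
def mset (r : ℝ) (e : EuclideanSpace ℝ (Fin n)) (w : EuclideanSpace ℝ (Fin m)) :
    Set (EuclideanSpace ℝ (Fin n)) :=
  {y | y ∈ unitCube n ∧ f y + w ∈ unitCube m ∧ y ∈ (fun x => r • x + e) '' K}

lemma mset_closed (hK : IsCompact K) (r : ℝ) (e : EuclideanSpace ℝ (Fin n))
    (w : EuclideanSpace ℝ (Fin m)) : IsClosed (mset K f r e w) := by
  have hf : Continuous f := f.continuous_of_finiteDimensional
  have h1 := (unitCube_isCompact n).isClosed
  have h2 : IsClosed {y | f y + w ∈ unitCube m} :=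
    (unitCube_isCompact m).isClosed.preimage (hf.add continuous_const)
  have h3 : IsClosed ((fun x => r • x + e) '' K) :=
    (hK.image (by fun_prop)).isClosed
  exact h1.inter (h2.inter h3)

lemma zset_mem {r : ℝ} {e1 : EuclideanSpace ℝ (Fin m)} {e2 : EuclideanSpace ℝ (Fin n)}
    {z : (Fin m → ℝ) × (Fin n → ℝ)} (hz : z ∈ zset K f r e1 e2) :
    WithLp.toLp 2 z.2 ∈ mset K f r e2 (e1 - f e2) ∧
      z.1 = (f (WithLp.toLp 2 z.2) + (e1 - f e2)).ofLp := by
  obtain ⟨⟨x, hx, hzx⟩, h1, h2⟩ := hz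
  have e : z.1 = (f (WithLp.toLp 2 z.2) + (e1 - f e2)).ofLp := by
    rw [hzx]
    simp only [WithLp.toLp_ofLp, map_add, map_smul]
    congr 1
    abel
  refine ⟨⟨mem_unitCube_of_lab h2, ?_, x, hx, ?_⟩, e⟩
  · apply mem_unitCube_of_lab
    rw [← e]; exact h1
  · rw [hzx]

/-- the set of base points with large fibres -/
def tset (D : ℝ) : Set (EuclideanSpace ℝ (Fin m)) :=
  {y | y ∈ f '' K ∧ ENNReal.ofReal D ≤ dimH (K ∩ f ⁻¹' {y})}

lemma limit_step (hKc : IsCompact K) (hK : IsHomogeneous K) {D D' : ℝ}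
    (t s : ℕ → ℝ) (ht0 : ∀ k, 0 < t k) (hs0 : ∀ k, 0 < s k)
    (ht : ∀ ε > 0, ∃ C : ℝ, 0 < C ∧ ∀ k : ℕ, t k ≤ C * (2 : ℝ) ^ (-((k : ℝ) * (D - ε))))
    (hs : ∃ C : ℝ, 0 < C ∧ ∀ k : ℕ, s k ≤ C * (2 : ℝ) ^ (-((k : ℝ) * D')))
    (hrec : ∀ N : ℕ, ∃ p ≥ N, ∃ Z ∈ zfam K f, ∃ Y : Finset (Fin m → ℤ),
      (∀ J : Finset (ℕ × (Fin m → ℤ)), (∀ j ∈ J, j.1 ≤ p) →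
        (∀ u ∈ Y, ∃ j ∈ J, tr (p - j.1) u = j.2) → 1 / 4 ≤ ∑ j ∈ J, s j.1) ∧
      (∀ u ∈ Y, ∀ J : Finset (ℕ × (Fin n → ℤ)), (∀ j ∈ J, j.1 ≤ p) →
        (∀ z ∈ Z, lab p z.1 = u → ∃ j ∈ J, lab j.1 z.2 = j.2) → 1 / 4 ≤ ∑ j ∈ J, t j.1)) :
    (tset K f D).Nonempty ∧ (0 < D' → ENNReal.ofReal D' ≤ dimH (tset K f D)) := by
  have hf : Continuous f := f.continuous_of_finiteDimensional
  choose p hp Z hZ Y hY1 hY2 using hrec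
  choose r e1 e2 hr hZs using hZ
  have hYne : ∀ i, (Y i).Nonempty := by
    intro i
    by_contra h
    rw [Finset.not_nonempty_iff_eq_empty] at h
    have := hY1 i ∅ (by simp) (by simp [h])
    norm_num at this
  have hZne : ∀ i, ∀ u ∈ Y i, ∃ z ∈ Z i, lab (p i) z.1 = u := by
    intro i u hu
    by_contra h
    push Not at h
    have := hY2 i u hu ∅ (by simp) (fun z hz hzu => absurd hzu (h z hz))
    norm_num at this
  let w : ℕ → EuclideanSpace ℝ (Fin m) := fun i => e1 i - f (e2 i)
  let M : ℕ → Set (EuclideanSpace ℝ (Fin n)) := fun i => mset K f (r i) (e2 i) (w i)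
  let V : ℕ → Set (EuclideanSpace ℝ (Fin m)) := fun i => lpt (p i) '' (Y i : Set (Fin m → ℤ))
  have hMc : ∀ i, IsClosed (M i) := fun i => mset_closed K f hKc _ _ _
  have hMn : ∀ i, (M i).Nonempty := by
    intro i
    obtain ⟨u, hu⟩ := hYne i
    obtain ⟨z, hz, _⟩ := hZne i u hu
    exact ⟨_, (zset_mem K f (hZs i hz)).1⟩
  have hMs : ∀ i, M i ⊆ unitCube n := fun i y hy => hy.1
  have hVc : ∀ i, IsClosed (V i) := fun i => ((Finset.finite_toSet _).image _).isClosed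
  have hVn : ∀ i, (V i).Nonempty := fun i => (Finset.coe_nonempty.2 (hYne i)).image _
  have hVs : ∀ i, V i ⊆ unitCube m := by
    rintro i _ ⟨u, hu, rfl⟩
    obtain ⟨z, hz, hzu⟩ := hZne i u hu
    exact lpt_mem (hZs i hz).2.1 hzu
  have hwB : ∀ i, w i ∈ (fun q : EuclideanSpace ℝ (Fin m) × EuclideanSpace ℝ (Fin n) =>
      q.1 - f q.2) '' (unitCube m ×ˢ unitCube n) := by
    intro i
    obtain ⟨y, hy⟩ := hMn i
    exact ⟨(f y + w i, y), ⟨hy.2.1, hy.1⟩, by simp⟩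
  have hBc : IsCompact ((fun q : EuclideanSpace ℝ (Fin m) × EuclideanSpace ℝ (Fin n) =>
      q.1 - f q.2) '' (unitCube m ×ˢ unitCube n)) :=
    ((unitCube_isCompact m).prod (unitCube_isCompact n)).image
      (continuous_fst.sub (hf.comp continuous_snd))
  obtain ⟨M', hM'c, hM'n, hM's, φ₁, hφ₁, hlim₁⟩ := blaschke (unitCube_isCompact n) M hMc hMn hMs
  obtain ⟨V', hV'c, hV'n, hV's, φ₂, hφ₂, hlim₂⟩ := blaschke (unitCube_isCompact m)
    (V ∘ φ₁) (fun i => hVc _) (fun i => hVn _) (fun i => hVs _)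
  obtain ⟨w', _, φ₃, hφ₃, hlim₃⟩ := hBc.tendsto_subseq (x := w ∘ φ₁ ∘ φ₂) (fun i => hwB _)
  let φ : ℕ → ℕ := φ₁ ∘ φ₂ ∘ φ₃
  have hφ : StrictMono φ := hφ₁.comp (hφ₂.comp hφ₃)
  have hM : Tendsto (fun i => hausdorffDist (M (φ i)) M') atTop (𝓝 0) :=
    hlim₁.comp (hφ₂.comp hφ₃).tendsto_atTop
  have hV : Tendsto (fun i => hausdorffDist (V (φ i)) V') atTop (𝓝 0) :=
    hlim₂.comp hφ₃.tendsto_atTop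
  have hw : Tendsto (fun i => w (φ i)) atTop (𝓝 w') := hlim₃
  have hpφ : ∀ i, i ≤ p (φ i) := fun i => (hφ.id_le i).trans (hp _)
  -- the fibres
  have hfib : ∀ y ∈ V', ∀ U, IsOpen U → {x ∈ M' | f x + w' = y} ⊆ U → ∀ N : ℕ,
      ∃ i ≥ N, ∃ u ∈ Y (φ i), ∀ z ∈ Z (φ i), lab (p (φ i)) z.1 = u → WithLp.toLp 2 z.2 ∈ U := by
    intro y hy U hU hsub N
    by_contra hcon
    push Not at hcon
    obtain ⟨v, hv, hvy⟩ := approx_limit (unitCube_isCompact m) (S := fun i => V (φ i))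
      (fun i => hVn _) (fun i => hVs _) hV's hV hy
    choose u hu huv using hv
    choose! z hz hzu hzU using fun i (hi : N ≤ i) => hcon i hi (u i) (hu i)
    let x : ℕ → EuclideanSpace ℝ (Fin n) := fun i => WithLp.toLp 2 (z (N + i)).2
    have hx : ∀ i, x i ∈ M (φ (N + i)) := fun i =>
      (zset_mem K f (hZs _ (hz (N + i) (by omega)))).1
    obtain ⟨x₀, _, ψ, hψ, hxl⟩ := (unitCube_isCompact n).tendsto_subseq
      (x := x) (fun i => hMs _ (hx i))
    have hNi : Tendsto (fun i : ℕ => N + i) atTop atTop :=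
      tendsto_atTop_mono (fun i => Nat.le_add_left i N) tendsto_id
    have hx₀M : x₀ ∈ M' := tendsto_mem_limit (unitCube_isCompact n) (S := fun i => M (φ (N + i)))
      (fun i => hMn _) (fun i => hMs _) hM'c hM'n hM's (hM.comp hNi) hx hψ hxl
    have hx₀U : x₀ ∈ Uᶜ := hU.isClosed_compl.mem_of_tendsto hxl
      (Eventually.of_forall fun i => hzU (N + ψ i) (by omega))
    refine hx₀U (hsub ⟨hx₀M, ?_⟩)
    have hNψ : Tendsto (fun i : ℕ => N + ψ i) atTop atTop := hNi.comp hψ.tendsto_atTop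
    have a1 : Tendsto (fun i => f ((x ∘ ψ) i) + w (φ (N + ψ i))) atTop (𝓝 (f x₀ + w')) :=
      ((hf.tendsto x₀).comp hxl).add (hw.comp hNψ)
    have a2 : Tendsto (fun i => v (N + ψ i)) atTop (𝓝 y) := hvy.comp hNψ
    have a3 : Tendsto (fun i => dist (f ((x ∘ ψ) i) + w (φ (N + ψ i))) (v (N + ψ i))) atTop (𝓝 0) := by
      have hpow : Tendsto (fun i : ℕ => √(Fintype.card (Fin m)) * (1 / 2 : ℝ) ^ (p (φ (N + ψ i))))
          atTop (𝓝 0) := by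
        have b1 : Tendsto (fun i : ℕ => p (φ (N + ψ i))) atTop atTop :=
          tendsto_atTop_mono (fun i => hpφ _) hNψ
        have b2 := (tendsto_pow_atTop_nhds_zero_of_lt_one (r := (1 / 2 : ℝ)) (by norm_num)
          (by norm_num)).comp b1
        have b3 := b2.const_mul (√(Fintype.card (Fin m)))
        rwa [mul_zero] at b3
      refine squeeze_zero (fun i => dist_nonneg) (fun i => ?_) hpow
      apply lab_dist
      rw [← huv (N + ψ i), lab_lpt, ← hzu (N + ψ i) (by omega)]
      congr 1
      exact (zset_mem K f (hZs _ (hz (N + ψ i) (by omega)))).2.symm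
    have a4 := a1.dist a2
    exact dist_eq_zero.1 (tendsto_nhds_unique a4 a3)
  have hfibc : ∀ y, IsCompact {x ∈ M' | f x + w' = y} := by
    intro y
    refine (unitCube_isCompact n).of_isClosed_subset ?_ (fun x hx => hM's hx.1)
    exact hM'c.inter (isClosed_eq (hf.add continuous_const) continuous_const)
  have hfibn : ∀ y ∈ V', {x ∈ M' | f x + w' = y}.Nonempty := by
    intro y hy
    by_contra h
    rw [not_nonempty_iff_eq_empty] at h
    obtain ⟨i, _, u, hu, hzz⟩ := hfib y hy ∅ isOpen_empty (by rw [h]) 0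
    obtain ⟨z, hz, hzu⟩ := hZne (φ i) u hu
    exact hzz z hz hzu
  have hfibd : ∀ y ∈ V', ENNReal.ofReal D ≤ dimH {x ∈ M' | f x + w' = y} := by
    intro y hy
    refine ofReal_le_of_forall fun d hd hdD => ?_
    obtain ⟨C, hC, htC⟩ := ht (D - d) (by linarith)
    refine mass_dist _ (hfibc y) hd hC t ht0 (by simpa using htC) ?_
    intro U hU hsub N
    obtain ⟨i, hi, u, hu, hzz⟩ := hfib y hy U hU hsub N
    refine ⟨p (φ i), hi.le.trans (hpφ i),
      {x | ∃ z ∈ Z (φ i), lab (p (φ i)) z.1 = u ∧ x = WithLp.toLp 2 z.2}, ?_, ?_⟩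
    · rintro _ ⟨z, hz, hzu, rfl⟩
      exact hzz z hz hzu
    · intro J hJ hcov
      exact hY2 (φ i) u hu J hJ fun z hz hzu => hcov _ ⟨z, hz, hzu, rfl⟩
  -- the limit is a miniset
  have hmini : IsMiniset K M' := hK.2 M' ⟨hM'c, hM'n, hM's, fun i => M (φ i), fun i =>
    ⟨hMc _, hMn _, hMs _, r (φ i), e2 (φ i), (hr _).trans (le_abs_self _), fun y hy => hy.2.2⟩, hM⟩
  obtain ⟨_, _, _, R, b, hR, hMR⟩ := hmini
  have hR0 : R ≠ 0 := by
    rintro rfl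
    norm_num at hR
  have hmem : ∀ y ∈ V', R⁻¹ • (y - w' - f b) ∈ tset K f D := by
    intro y hy
    have key : {x ∈ M' | f x + w' = y} ⊆
        (fun x => R • x + b) '' (K ∩ f ⁻¹' {R⁻¹ • (y - w' - f b)}) := by
      rintro x ⟨hx, hxy⟩
      obtain ⟨k, hk, hkx⟩ := hMR hx
      refine ⟨k, ⟨hk, ?_⟩, hkx⟩
      simp only [mem_preimage, mem_singleton_iff]
      rw [← hxy, ← hkx]
      simp only [map_add, map_smul]
      rw [show R • f k + f b + w' - w' - f b = R • f k by abel, smul_smul, inv_mul_cancel₀ hR0,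
        one_smul]
    constructor
    · obtain ⟨x, hx⟩ := hfibn y hy
      obtain ⟨k, ⟨hk, hk2⟩, _⟩ := key hx
      exact ⟨k, hk, hk2⟩
    · refine (hfibd y hy).trans ((dimH_mono key).trans ?_)
      have hl : LipschitzWith ‖R‖₊ (fun x : EuclideanSpace ℝ (Fin n) => R • x + b) :=
        LipschitzWith.of_dist_le_mul fun x y => by
          rw [dist_add_right, dist_smul₀]; rfl
      exact hl.dimH_image_le _
  refine ⟨?_, fun hD' => ?_⟩
  · obtain ⟨y, hy⟩ := hV'n
    exact ⟨_, hmem y hy⟩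
  · obtain ⟨C, hC, hsC⟩ := hs
    have h1 : ENNReal.ofReal D' ≤ dimH V' := by
      refine mass_dist _ ((unitCube_isCompact m).of_isClosed_subset hV'c hV's) hD' hC s hs0 hsC ?_
      intro U hU hsub N
      have hev := eventually_subset (unitCube_isCompact m) (S := fun i => V (φ i))
        (fun i => hVn _) (fun i => hVs _) hV'c hV'n hV's hV hU hsub
      obtain ⟨i, hi1, hi2⟩ := (hev.and (eventually_ge_atTop N)).exists
      refine ⟨p (φ i), hi2.trans (hpφ i), V (φ i), hi1, fun J hJ hcov => ?_⟩
      refine hY1 (φ i) J hJ fun u hu => ?_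
      obtain ⟨j, hj, hju⟩ := hcov _ ⟨u, hu, rfl⟩
      exact ⟨j, hj, by rw [← hju, lab_lpt_le (hJ j hj)]⟩
    refine h1.trans ?_
    have key : V' ⊆ (fun y => R • y + (f b + w')) '' tset K f D := by
      intro y hy
      refine ⟨_, hmem y hy, ?_⟩
      simp only
      rw [smul_smul, mul_inv_cancel₀ hR0, one_smul]
      abel
    refine (dimH_mono key).trans ?_
    have hl : LipschitzWith ‖R‖₊ (fun x : EuclideanSpace ℝ (Fin m) => R • x + (f b + w')) :=
      LipschitzWith.of_dist_le_mul fun x y => by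
        rw [dist_add_right, dist_smul₀]; rfl
    exact hl.dimH_image_le _

end Final

/-- **Furstenberg's dimension conservation theorem.** If `K ⊆ [0,1]ⁿ` is a homogeneous
compact set and `f : ℝⁿ → ℝᵐ` is linear, then `f` is dimension conserving for `K`:
there is `Δ ≥ 0` with `Δ + dim {y ∈ f(K) : dim (K ∩ f⁻¹(y)) ≥ Δ} ≥ dim K` (the convention
`dim ∅ = −∞` being encoded by requiring that set of `y` to be nonempty when `K` is). -/
theorem homogeneous_dimension_conservation {n m : ℕ}
    (K : Set (EuclideanSpace ℝ (Fin n))) (hKc : IsCompact K) (hK : IsHomogeneous K)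
    (f : EuclideanSpace ℝ (Fin n) →ₗ[ℝ] EuclideanSpace ℝ (Fin m)) :
    ∃ Δ : ℝ, 0 ≤ Δ ∧
      (K.Nonempty →
        {y | y ∈ f '' K ∧ ENNReal.ofReal Δ ≤ dimH (K ∩ f ⁻¹' {y})}.Nonempty) ∧
      dimH K ≤ ENNReal.ofReal Δ +
        dimH {y | y ∈ f '' K ∧ ENNReal.ofReal Δ ≤ dimH (K ∩ f ⁻¹' {y})} := by
  rcases K.eq_empty_or_nonempty with rfl | hne
  · exact ⟨0, le_rfl, fun h => absurd h not_nonempty_empty, by rw [dimH_empty]; exact zero_le⟩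
  obtain ⟨δ, Δ, hδ, hΔ, hup, hlow⟩ := core (zfam_zoom K f hne)
  refine ⟨Δ, hΔ, fun _ => ?_, ?_⟩
  · obtain ⟨t, s, ht0, hs0, ht, hs, hrec⟩ := hlow 1 one_pos
    exact (limit_step K f hKc hK t s ht0 hs0 ht hs hrec).1
  · refine (dim_upper K f hne hδ hup).trans ?_
    have h1 : ENNReal.ofReal (δ - Δ) ≤ dimH (tset K f Δ) := by
      refine ofReal_le_of_forall fun d hd hdD => ?_
      obtain ⟨t, s, ht0, hs0, ht, hs, hrec⟩ := hlow (δ - Δ - d) (by linarith)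
      rw [show δ - Δ - (δ - Δ - d) = d by ring] at hs
      exact (limit_step K f hKc hK t s ht0 hs0 ht hs hrec).2 hd
    calc ENNReal.ofReal δ = ENNReal.ofReal (Δ + (δ - Δ)) := by congr 1; ring
      _ ≤ ENNReal.ofReal Δ + ENNReal.ofReal (δ - Δ) := ENNReal.ofReal_add_le
      _ ≤ _ := by gcongr; exact h1

end
end

section
/- If K is a graph-directed set (a component K_i of the attractor of a graph-directed IFS of contracting similarities over a transitive directed graph), then its Hausdorff dimension equals its upper box dimension: dim K = upper box dimension of K. -/
open Set Metric MeasureTheory Module Filter Topology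
open scoped ENNReal NNReal RealInnerProductSpace

noncomputable section
/-- `coverNumber A δ` is the least number of closed `δ`-balls needed to cover `A`
(`⊤` if no finite cover exists). -/
def coverNumber {X : Type*} [PseudoMetricSpace X] (A : Set X) (δ : ℝ) : ℕ∞ :=
  sInf {m : ℕ∞ | ∃ s : Finset X, (s.card : ℕ∞) = m ∧ A ⊆ ⋃ x ∈ s, Metric.closedBall x δ}

/-- The upper box (Minkowski) dimension of a set in a metric space:
`limsup_{δ → 0⁺} log N(A,δ) / log (1/δ)`. -/
def upperBoxDim {X : Type*} [PseudoMetricSpace X] (A : Set X) : ℝ≥0∞ :=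
  Filter.limsup (fun δ : ℝ =>
      if coverNumber A δ = ⊤ then (⊤ : ℝ≥0∞)
      else ENNReal.ofReal (Real.log ((coverNumber A δ).toNat) / Real.log (1 / δ)))
    (nhdsWithin 0 (Set.Ioi 0))

/-- The packing dimension of a set: the infimum, over countable decompositions of `A`
into bounded pieces, of the supremum of the upper box dimensions of the pieces. -/
def packingDim {X : Type*} [PseudoMetricSpace X] (A : Set X) : ℝ≥0∞ :=
  ⨅ (C : ℕ → Set X) (_ : A = ⋃ i, C i) (_ : ∀ i, Bornology.IsBounded (C i)),
    ⨆ i, upperBoxDim (C i)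

/-- The `s`-dimensional Hausdorff content of a set: the infimum of `∑ (diam Fᵢ)^s` over
countable covers of `A` (empty sets contributing `0`). -/
def hausdorffContent {X : Type*} [PseudoEMetricSpace X] (s : ℝ) (A : Set X) : ℝ≥0∞ :=
  ⨅ (F : ℕ → Set X) (_ : A ⊆ ⋃ i, F i),
    ∑' i, ⨆ (_ : (F i).Nonempty), EMetric.diam (F i) ^ s

/-- `IsPathFrom src tgt i j p`: the list of edges `p` forms a path from vertex `i` to
vertex `j` in the directed graph with source and target maps `src`, `tgt`. -/
def IsPathFrom {V Edge : Type*} (src tgt : Edge → V) : V → V → List Edge → Prop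
  | i, j, [] => i = j
  | i, j, e :: p => src e = i ∧ IsPathFrom src tgt (tgt e) j p

/-- The transformation group of the vertex `i` of a graph-directed IFS whose similarities
have orthogonal parts `T e`: the subgroup of `O(n)` generated by the compositions
`T e₁ ∘ ⋯ ∘ T e_ℓ` over all (nonempty) paths `(e₁, …, e_ℓ)` from `i` to `i`. -/
def transfGroup {V Edge : Type*} {n : ℕ} (src tgt : Edge → V)
    (T : Edge → (EuclideanSpace ℝ (Fin n) ≃ₗᵢ[ℝ] EuclideanSpace ℝ (Fin n))) (i : V) :
    Subgroup (EuclideanSpace ℝ (Fin n) ≃ₗᵢ[ℝ] EuclideanSpace ℝ (Fin n)) :=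
  Subgroup.closure
    {S | ∃ p : List Edge, p ≠ [] ∧ IsPathFrom src tgt i i p ∧ S = (p.map T).prod}

/-! ### Covering numbers -/

lemma exists_finset_of_coverNumber_ne_top {X : Type*} [PseudoMetricSpace X] {A : Set X} {δ : ℝ}
    (h : coverNumber A δ ≠ ⊤) :
    ∃ s : Finset X, s.card = (coverNumber A δ).toNat ∧ A ⊆ ⋃ x ∈ s, Metric.closedBall x δ := by
  have hne : {m : ℕ∞ | ∃ s : Finset X, (s.card : ℕ∞) = m ∧
      A ⊆ ⋃ x ∈ s, Metric.closedBall x δ}.Nonempty := by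
    by_contra hcon
    rw [Set.not_nonempty_iff_eq_empty] at hcon
    apply h
    unfold coverNumber
    rw [hcon, sInf_empty]
  obtain ⟨s, hs, hA⟩ := csInf_mem hne
  refine ⟨s, ?_, hA⟩
  have : (s.card : ℕ∞) = coverNumber A δ := hs
  rw [← this]
  simp

lemma exists_separated_finset {X : Type*} [PseudoMetricSpace X] {A : Set X} {δ : ℝ} (hδ : 0 ≤ δ)
    (k : ℕ) (hk : (k : ℕ∞) ≤ coverNumber A δ) :
    ∃ s : Finset X, s.card = k ∧ (∀ x ∈ s, x ∈ A) ∧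
      ∀ x ∈ s, ∀ y ∈ s, x ≠ y → δ < dist x y := by
  classical
  induction k with
  | zero => exact ⟨∅, by simp⟩
  | succ k ih =>
    have hlt : (k : ℕ∞) < coverNumber A δ :=
      lt_of_lt_of_le (by exact_mod_cast Nat.lt_succ_self k) hk
    obtain ⟨s, hsc, hsA, hsep⟩ := ih hlt.le
    have hnot : ¬ A ⊆ ⋃ x ∈ s, Metric.closedBall x δ := by
      intro hc
      have : coverNumber A δ ≤ (s.card : ℕ∞) := sInf_le ⟨s, rfl, hc⟩
      rw [hsc] at this
      exact absurd hlt (not_lt.mpr this)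
    obtain ⟨z, hzA, hz⟩ := Set.not_subset.mp hnot
    have hz' : ∀ x ∈ s, δ < dist z x := by
      intro x hx
      by_contra hcon
      exact hz (Set.mem_biUnion hx (Metric.mem_closedBall.mpr (not_lt.mp hcon)))
    have hzs : z ∉ s := fun h => by
      have := hz' z h
      rw [dist_self] at this
      linarith
    refine ⟨insert z s, by rw [Finset.card_insert_of_notMem hzs, hsc], ?_, ?_⟩
    · intro x hx
      rcases Finset.mem_insert.mp hx with rfl | h
      · exact hzA
      · exact hsA x h
    · intro x hx y hy hxy
      rcases Finset.mem_insert.mp hx with rfl | h <;> rcases Finset.mem_insert.mp hy with rfl | h'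
      · exact absurd rfl hxy
      · exact hz' y h'
      · rw [dist_comm]; exact hz' x h
      · exact hsep x h y h' hxy

/-! ### Hausdorff dimension is at most the upper box dimension -/

lemma dimH_le_upperBoxDim {X : Type*} [MetricSpace X] (A : Set X) :
    dimH A ≤ upperBoxDim A := by
  borelize X
  refine ENNReal.le_of_forall_nnreal_lt (fun s hs => ?_) |> id
  by_contra hcon
  rw [not_le] at hcon
  have hs' := hausdorffMeasure_of_lt_dimH hs
  have hev := Filter.eventually_lt_of_limsup_lt hcon
  have hev1 : ∀ᶠ δ : ℝ in 𝓝[>] 0, δ ∈ Set.Ioo (0:ℝ) 1 :=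
    Ioo_mem_nhdsGT one_pos
  have key : ∀ᶠ δ : ℝ in 𝓝[>] 0, 0 < δ ∧ ∃ t : Finset X,
      (t.card : ℝ) ≤ δ ^ (-(s:ℝ)) ∧ A ⊆ ⋃ x ∈ t, Metric.closedBall x δ := by
    filter_upwards [hev, hev1] with δ h1 h2
    refine ⟨h2.1, ?_⟩
    split_ifs at h1 with h3
    · exact absurd h1 (by simp)
    · obtain ⟨t, htc, htA⟩ := exists_finset_of_coverNumber_ne_top h3
      refine ⟨t, ?_, htA⟩
      rw [← htc] at h1
      have hl : 0 < Real.log (1/δ) := Real.log_pos (by rw [lt_div_iff₀ h2.1]; linarith [h2.2])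
      have h4 : Real.log t.card / Real.log (1/δ) < s := by
        by_contra hc
        rw [not_lt] at hc
        have := ENNReal.ofReal_le_ofReal hc
        rw [ENNReal.ofReal_coe_nnreal] at this
        exact absurd h1 (not_lt.mpr this)
      rw [div_lt_iff₀ hl] at h4
      rcases Nat.eq_zero_or_pos t.card with h0 | h0
      · rw [h0]; simpa using Real.rpow_nonneg h2.1.le _
      · have h0' : (0:ℝ) < t.card := by exact_mod_cast h0
        rw [← Real.log_le_log_iff h0' (Real.rpow_pos_of_pos h2.1 _), Real.log_rpow h2.1]
        rw [one_div, Real.log_inv] at h4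
        linarith
  have hch : ∀ δ : ℝ, ∃ t : Finset X, (0 < δ ∧ ∃ t : Finset X,
      (t.card : ℝ) ≤ δ ^ (-(s:ℝ)) ∧ A ⊆ ⋃ x ∈ t, Metric.closedBall x δ) →
      ((t.card : ℝ) ≤ δ ^ (-(s:ℝ)) ∧ A ⊆ ⋃ x ∈ t, Metric.closedBall x δ) := by
    intro δ
    by_cases h : (0 < δ ∧ ∃ t : Finset X,
      (t.card : ℝ) ≤ δ ^ (-(s:ℝ)) ∧ A ⊆ ⋃ x ∈ t, Metric.closedBall x δ)
    · obtain ⟨t, ht⟩ := h.2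
      exact ⟨t, fun _ => ht⟩
    · exact ⟨∅, fun h' => absurd h' h⟩
  choose t ht using hch
  have hdiam : ∀ (δ : ℝ) (x : X), 0 < δ →
      Metric.ediam (Metric.closedBall x δ) ≤ ENNReal.ofReal (2 * δ) := by
    intro δ x hδ
    refine Metric.ediam_le fun y hy z hz => ?_
    rw [edist_dist]
    apply ENNReal.ofReal_le_ofReal
    have := dist_triangle_right y z x
    rw [Metric.mem_closedBall] at hy hz
    linarith
  have hle := Measure.hausdorffMeasure_le_liminf_sum (X := X) (β := ℝ) (ι := fun δ => (t δ)) (s:ℝ) A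
    (l := 𝓝[>] (0:ℝ)) (fun δ => ENNReal.ofReal (2 * δ))
    (by
      have : Tendsto (fun δ : ℝ => ENNReal.ofReal (2 * δ)) (𝓝 0) (𝓝 (ENNReal.ofReal (2 * 0))) :=
        (ENNReal.continuous_ofReal.comp (continuous_const.mul continuous_id)).tendsto 0
      rw [mul_zero, ENNReal.ofReal_zero] at this
      exact this.mono_left nhdsWithin_le_nhds)
    (fun δ x => Metric.closedBall (x : X) δ)
    (by
      filter_upwards [hev1] with δ h x
      exact hdiam δ _ h.1)
    (by
      filter_upwards [key] with δ h
      have := (ht δ h).2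
      intro y hy
      obtain ⟨x, hx, hyx⟩ := Set.mem_iUnion₂.mp (this hy)
      exact Set.mem_iUnion.mpr ⟨⟨x, hx⟩, hyx⟩)
  rw [hs', top_le_iff] at hle
  have hbd : liminf (fun δ => ∑ x : (t δ), Metric.ediam (Metric.closedBall (x : X) δ) ^ (s:ℝ))
      (𝓝[>] (0:ℝ)) ≤ ENNReal.ofReal (2 ^ (s:ℝ)) := by
    refine Filter.liminf_le_of_frequently_le' (Eventually.frequently ?_)
    filter_upwards [key] with δ h
    have hδ := h.1
    have h2 := (ht δ h).1
    calc ∑ x : (t δ), Metric.ediam (Metric.closedBall (x : X) δ) ^ (s:ℝ)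
        ≤ ∑ x : (t δ), ENNReal.ofReal ((2 * δ) ^ (s:ℝ)) := by
          refine Finset.sum_le_sum fun x _ => ?_
          rw [← ENNReal.ofReal_rpow_of_pos (by positivity)]
          exact ENNReal.rpow_le_rpow (hdiam δ _ hδ) s.2
      _ = ENNReal.ofReal ((t δ).card * (2 * δ) ^ (s:ℝ)) := by
          rw [Finset.sum_const, Finset.card_univ, Fintype.card_coe, nsmul_eq_mul,
            ENNReal.ofReal_mul (by positivity), ENNReal.ofReal_natCast]
      _ ≤ ENNReal.ofReal (2 ^ (s:ℝ)) := by
          apply ENNReal.ofReal_le_ofReal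
          rw [Real.mul_rpow (by norm_num) hδ.le]
          have h5 : 0 < δ ^ (s:ℝ) := Real.rpow_pos_of_pos hδ _
          have h6 : δ ^ (-(s:ℝ)) * δ ^ (s:ℝ) = 1 := by
            rw [← Real.rpow_add hδ]; simp
          calc ((t δ).card : ℝ) * (2 ^ (s:ℝ) * δ ^ (s:ℝ))
              ≤ δ ^ (-(s:ℝ)) * (2 ^ (s:ℝ) * δ ^ (s:ℝ)) := by gcongr
            _ = 2 ^ (s:ℝ) * (δ ^ (-(s:ℝ)) * δ ^ (s:ℝ)) := by ring
            _ = 2 ^ (s:ℝ) := by rw [h6, mul_one]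
  rw [hle] at hbd
  exact absurd hbd (by simp)

/-! ### Separated systems of expanding copies -/

/-- The level `k` cylinder of the code `w`. -/
def cyl {X : Type*} {m : ℕ} (f : Fin m → X → X) (K : Set X) : ℕ → (ℕ → Fin m) → Set X
  | 0, _ => K
  | k + 1, w => f (w 0) '' cyl f K k (fun j => w (j + 1))

lemma cyl_subset {X : Type*} {m : ℕ} {f : Fin m → X → X} {K : Set X}
    (hf : ∀ a, MapsTo (f a) K K) (k : ℕ) (w : ℕ → Fin m) : cyl f K k w ⊆ K := by
  induction k generalizing w with
  | zero => exact subset_rfl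
  | succ k ih =>
    rintro _ ⟨x, hx, rfl⟩
    exact hf _ (ih _ hx)

lemma cyl_anti {X : Type*} {m : ℕ} {f : Fin m → X → X} {K : Set X}
    (hf : ∀ a, MapsTo (f a) K K) (k : ℕ) (w : ℕ → Fin m) : cyl f K (k+1) w ⊆ cyl f K k w := by
  induction k generalizing w with
  | zero => exact cyl_subset hf 1 w
  | succ k ih => exact Set.image_mono (ih _)

lemma cyl_sep {X : Type*} [MetricSpace X] {m : ℕ} {f : Fin m → X → X} {K : Set X}
    (hf : ∀ a, MapsTo (f a) K K) {ρ η : ℝ} (hρ : 0 < ρ)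
    (hexp : ∀ a, ∀ x ∈ K, ∀ y ∈ K, ρ * dist x y ≤ dist (f a x) (f a y))
    (hsep : ∀ a b, a ≠ b → ∀ x ∈ K, ∀ y ∈ K, η ≤ dist (f a x) (f b y))
    (k : ℕ) (w v : ℕ → Fin m) (hlt : ∀ j < k, w j = v j) (hne : w k ≠ v k)
    (x y : X) (hx : x ∈ cyl f K (k+1) w) (hy : y ∈ cyl f K (k+1) v) :
    ρ ^ k * η ≤ dist x y := by
  induction k generalizing w v x y with
  | zero =>
    obtain ⟨x', hx', rfl⟩ := hx
    obtain ⟨y', hy', rfl⟩ := hy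
    simpa using hsep _ _ hne x' hx' y' hy'
  | succ k ih =>
    obtain ⟨x', hx', rfl⟩ := hx
    obtain ⟨y', hy', rfl⟩ := hy
    have h1 := ih (fun j => w (j+1)) (fun j => v (j+1)) (fun j hj => hlt (j+1) (by omega)) hne
      x' y' hx' hy'
    have h2 := hexp (w 0) x' (cyl_subset hf _ _ hx') y' (cyl_subset hf _ _ hy')
    rw [← hlt 0 (by omega)]
    calc ρ ^ (k+1) * η = ρ * (ρ ^ k * η) := by ring
      _ ≤ ρ * dist x' y' := by gcongr
      _ ≤ _ := h2

lemma le_dimH_of_separated {X : Type*} [MetricSpace X] {m : ℕ} (hm : 1 < m) {f : Fin m → X → X}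
    {K : Set X} (hK : IsCompact K) (hKne : K.Nonempty) (hcont : ∀ a, Continuous (f a))
    (hf : ∀ a, MapsTo (f a) K K) {ρ η : ℝ} (hρ : 0 < ρ) (hη : 0 < η)
    (hexp : ∀ a, ∀ x ∈ K, ∀ y ∈ K, ρ * dist x y ≤ dist (f a x) (f a y))
    (hsep : ∀ a b, a ≠ b → ∀ x ∈ K, ∀ y ∈ K, η ≤ dist (f a x) (f b y))
    (t : ℝ≥0) (ht : 0 < t) (hmt : 1 ≤ m * ρ ^ (t:ℝ)) : (t : ℝ≥0∞) ≤ dimH K := by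
  have hcpt : ∀ k w, IsCompact (cyl f K k w) := by
    intro k
    induction k with
    | zero => intro w; exact hK
    | succ k ih => intro w; exact (ih _).image (hcont _)
  have hnemp : ∀ k w, (cyl f K k w).Nonempty := by
    intro k
    induction k with
    | zero => intro w; exact hKne
    | succ k ih => intro w; exact (ih _).image _
  have hpt : ∀ w, ∃ x, ∀ k, x ∈ cyl f K k w := by
    intro w
    obtain ⟨x, hx⟩ := IsCompact.nonempty_iInter_of_sequence_nonempty_isCompact_isClosed
      (fun k => cyl f K k w) (fun k => cyl_anti hf k w) (fun k => hnemp k w) (hcpt 0 w)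
      (fun k => (hcpt k w).isClosed)
    exact ⟨x, fun k => Set.mem_iInter.mp hx k⟩
  choose p hp using hpt
  have hm0 : (0:ℝ) < m := by exact_mod_cast (by omega : 0 < m)
  have hbound : ∀ w v, |Real.ofDigits w - Real.ofDigits v| ≤ (dist (p w) (p v) / η) ^ (t:ℝ) := by
    intro w v
    by_cases hwv : w = v
    · subst hwv
      simp only [sub_self, abs_zero]
      exact Real.rpow_nonneg (by positivity) _
    · have hex : ∃ k, w k ≠ v k := by
        by_contra hc
        push Not at hc
        exact hwv (funext hc)
      classical
      have hk := Nat.find_spec hex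
      have hlt : ∀ j < Nat.find hex, w j = v j := fun j hj => by
        simpa using Nat.find_min hex hj
      generalize Nat.find hex = k at hk hlt
      have h1 := cyl_sep hf hρ hexp hsep k w v hlt hk _ _ (hp w (k+1)) (hp v (k+1))
      have h2 := Real.abs_ofDigits_sub_ofDigits_le hlt
      refine h2.trans ?_
      have h3 : ρ ^ k ≤ dist (p w) (p v) / η := by rwa [le_div_iff₀ hη]
      have h4 : (ρ ^ k) ^ (t:ℝ) ≤ (dist (p w) (p v) / η) ^ (t:ℝ) :=
        Real.rpow_le_rpow (by positivity) h3 t.2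
      refine le_trans ?_ h4
      rw [← Real.rpow_natCast ρ k, ← Real.rpow_mul hρ.le, mul_comm, Real.rpow_mul hρ.le,
        Real.rpow_natCast]
      rw [inv_le_iff_one_le_mul₀ (by positivity), ← mul_pow, mul_comm]
      exact one_le_pow₀ hmt
  have hinj : Function.Injective p := by
    intro w v hwv
    by_contra hne
    have hex : ∃ k, w k ≠ v k := by
      by_contra hc
      push Not at hc
      exact hne (funext hc)
    classical
    have hk := Nat.find_spec hex
    have hlt : ∀ j < Nat.find hex, w j = v j := fun j hj => by
      simpa using Nat.find_min hex hj
    generalize Nat.find hex = k at hk hlt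
    have h1 := cyl_sep hf hρ hexp hsep k w v hlt hk _ _ (hp w (k+1)) (hp v (k+1))
    rw [hwv, dist_self] at h1
    have : 0 < ρ ^ k * η := by positivity
    linarith
  have : Nonempty (ℕ → Fin m) := ⟨fun _ => ⟨0, by omega⟩⟩
  set h : X → ℝ := fun x => Real.ofDigits (Function.invFun p x) with hh
  have hhp : ∀ w, h (p w) = Real.ofDigits w := fun w => by
    simp only [hh, Function.leftInverse_invFun hinj w]
  have hholder : HolderOnWith (Real.toNNReal ((1/η) ^ (t:ℝ))) t h (range p) := by
    rintro _ ⟨w, rfl⟩ _ ⟨v, rfl⟩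
    rw [hhp, hhp, edist_dist, edist_dist, Real.dist_eq,
      ENNReal.ofReal_rpow_of_nonneg dist_nonneg (NNReal.coe_nonneg t), ENNReal.ofNNReal_toNNReal,
      ← ENNReal.ofReal_mul (Real.rpow_nonneg (by positivity) _)]
    apply ENNReal.ofReal_le_ofReal
    rw [← Real.mul_rpow (by positivity) dist_nonneg]
    convert hbound w v using 2
    ring
  have hd := hholder.dimH_image_le ht
  have himg : Set.Icc (0:ℝ) 1 ⊆ h '' range p := by
    intro y hy
    obtain ⟨w, -, hw⟩ := Real.ofDigits_SurjOn hm hy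
    exact ⟨p w, ⟨w, rfl⟩, by rw [hhp, hw]⟩
  have h1 : (1 : ℝ≥0∞) ≤ dimH (h '' range p) := by
    have : dimH (Set.Icc (0:ℝ) 1) = 1 := by
      rw [Real.dimH_of_nonempty_interior (by rw [interior_Icc]; exact ⟨1/2, by norm_num⟩)]
      simp
    rw [← this]
    exact dimH_mono himg
  have hsub : range p ⊆ K := by
    rintro _ ⟨w, rfl⟩
    exact hp w 0
  have h2 : (1 : ℝ≥0∞) ≤ dimH K / t :=
    (h1.trans hd).trans (ENNReal.div_le_div_right (dimH_mono hsub) _)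
  rwa [ENNReal.le_div_iff_mul_le (Or.inl (by exact_mod_cast ht.ne')) (Or.inl ENNReal.coe_ne_top),
    one_mul] at h2

/-- If a compact set contains, in each small ball centred on it, a uniformly expanded copy of
itself, then its upper box dimension is at most its Hausdorff dimension. -/
lemma upperBoxDim_le_dimH_of_copies {X : Type*} [MetricSpace X] {K : Set X} (hK : IsCompact K)
    (hKne : K.Nonempty) {c : ℝ} (hc : 0 < c)
    (hcopy : ∀ r : ℝ, 0 < r → r ≤ 1 → ∀ x ∈ K, ∃ f : X → X, Continuous f ∧ MapsTo f K K ∧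
      (∀ y ∈ K, dist (f y) x ≤ r) ∧ ∀ y ∈ K, ∀ z ∈ K, c * r * dist y z ≤ dist (f y) (f z)) :
    upperBoxDim K ≤ dimH K := by
  refine ENNReal.le_of_forall_nnreal_lt fun t htlt => ?_
  rcases eq_or_ne t 0 with rfl | ht0
  · simp
  have ht : 0 < t := pos_iff_ne_zero.mpr ht0
  obtain ⟨u, htu, hu⟩ := ENNReal.lt_iff_exists_nnreal_btwn.mp htlt
  have htu' : (t:ℝ) < u := by exact_mod_cast htu
  have hu0 : (0:ℝ) < u := lt_of_le_of_lt t.2 htu'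
  have hfr := Filter.frequently_lt_of_lt_limsup (by isBoundedDefault) hu
  have hsmall : ∀ᶠ δ : ℝ in 𝓝[>] 0, δ ^ ((u:ℝ) - t) < (c/3) ^ (t:ℝ) := by
    have h1 : Tendsto (fun δ : ℝ => δ ^ ((u:ℝ) - t)) (𝓝 0) (𝓝 ((0:ℝ) ^ ((u:ℝ)-t))) :=
      (Real.continuousAt_rpow_const 0 _ (Or.inr (by linarith))).tendsto
    rw [Real.zero_rpow (by linarith)] at h1
    exact (h1.mono_left nhdsWithin_le_nhds).eventually
      (gt_mem_nhds (Real.rpow_pos_of_pos (by positivity) _))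
  have hIoo : ∀ᶠ δ : ℝ in 𝓝[>] 0, δ ∈ Set.Ioo (0:ℝ) 1 := Ioo_mem_nhdsGT one_pos
  obtain ⟨δ, hδu, hδ1, hδs⟩ := (hfr.and_eventually
    (hIoo.and hsmall)).exists
  obtain ⟨hδ0, hδ1⟩ : 0 < δ ∧ δ < 1 := hδ1
  have hk : ∃ k : ℕ, (k : ℕ∞) ≤ coverNumber K δ ∧ δ ^ (-(u:ℝ)) ≤ k := by
    split_ifs at hδu with h3
    · obtain ⟨k, hk⟩ := exists_nat_ge (δ ^ (-(u:ℝ)))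
      exact ⟨k, by rw [h3]; exact le_top, hk⟩
    · refine ⟨(coverNumber K δ).toNat, ENat.natCast_toNat_le_self _, ?_⟩
      generalize (coverNumber K δ).toNat = N at hδu
      have hl : 0 < Real.log (1/δ) := Real.log_pos (by rw [lt_div_iff₀ hδ0]; linarith)
      rw [← ENNReal.ofReal_coe_nnreal] at hδu
      replace hδu := (ENNReal.ofReal_lt_ofReal_iff_of_nonneg (NNReal.coe_nonneg u)).mp hδu
      rw [lt_div_iff₀ hl] at hδu
      have hN : (0:ℝ) < N := by
        rcases Nat.eq_zero_or_pos N with h0 | h0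
        · rw [h0] at hδu
          simp only [Nat.cast_zero, Real.log_zero] at hδu
          exact absurd hδu (not_lt.mpr (by positivity))
        · exact_mod_cast h0
      rw [← Real.log_le_log_iff (Real.rpow_pos_of_pos hδ0 _) hN, Real.log_rpow hδ0]
      rw [one_div, Real.log_inv] at hδu
      linarith
  obtain ⟨m, hmc, hmδ⟩ := hk
  obtain ⟨s, hsc, hsK, hsep⟩ := exists_separated_finset hδ0.le m hmc
  have hm1 : 1 < m := by
    have : (1:ℝ) < m := lt_of_lt_of_le
      (Real.one_lt_rpow_of_pos_of_lt_one_of_neg hδ0 hδ1 (by linarith)) hmδ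
    exact_mod_cast this
  have e : Fin m ≃ s := (Fintype.equivFinOfCardEq (by simpa using hsc)).symm
  have hcp : ∀ a : Fin m, _ := fun a =>
    hcopy (δ/3) (by positivity) (by linarith) (e a : X) (hsK _ (e a).2)
  choose f hfc hfK hfb hfe using hcp
  refine le_dimH_of_separated (ρ := c * (δ/3)) (η := δ/3) hm1 hK hKne hfc hfK (by positivity)
    (by positivity) hfe ?_ t ht ?_
  · intro a b hab x hx y hy
    have h1 : δ < dist (e a : X) (e b : X) := hsep _ (e a).2 _ (e b).2 (fun h =>
      hab (e.injective (Subtype.ext h)))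
    have h2 := hfb a x hx
    have h3 := hfb b y hy
    have h4 := dist_triangle4 (e a : X) (f a x) (f b y) (e b)
    rw [dist_comm (e a : X) (f a x)] at h4
    linarith
  · have h1 : 0 < δ ^ (t:ℝ) := Real.rpow_pos_of_pos hδ0 _
    have h2 : c * (δ/3) = (c/3) * δ := by ring
    rw [h2, Real.mul_rpow (by positivity) hδ0.le]
    calc (1:ℝ) = δ ^ (-(u:ℝ)) * (δ ^ ((u:ℝ)-t) * δ ^ (t:ℝ)) := by
          rw [← Real.rpow_add hδ0, ← Real.rpow_add hδ0]; simp
      _ ≤ m * ((c/3) ^ (t:ℝ) * δ ^ (t:ℝ)) := by gcongr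

/-! ### Graph-directed sets -/

/-- `f` is a similarity of ratio `r` mapping `B` into `A`. -/
def SimInto {X : Type*} [MetricSpace X] (A B : Set X) (r : ℝ) (f : X → X) : Prop :=
  0 < r ∧ MapsTo f B A ∧ ∀ y z, dist (f y) (f z) = r * dist y z

lemma SimInto.comp {X : Type*} [MetricSpace X] {A B C : Set X} {r r' : ℝ} {f f' : X → X}
    (h : SimInto A B r f) (h' : SimInto B C r' f') : SimInto A C (r * r') (f ∘ f') :=
  ⟨mul_pos h.1 h'.1, h.2.1.comp h'.2.1, fun y z => by
    simp only [Function.comp, h.2.2, h'.2.2, mul_assoc]⟩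

lemma SimInto.refl {X : Type*} [MetricSpace X] (A : Set X) : SimInto A A 1 id :=
  ⟨one_pos, mapsTo_id A, fun y z => by simp⟩

lemma SimInto.continuous {X : Type*} [MetricSpace X] {A B : Set X} {r : ℝ} {f : X → X}
    (h : SimInto A B r f) : Continuous f := by
  have : LipschitzWith ⟨r, h.1.le⟩ f := LipschitzWith.of_dist_le_mul fun x y => (h.2.2 x y).le
  exact this.continuous

lemma exists_simInto_of_path {X V Edge : Type*} [MetricSpace X] {src tgt : Edge → V}
    {a : Edge → ℝ} {g : Edge → X → X} {K : V → Set X}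
    (hs : ∀ e, SimInto (K (src e)) (K (tgt e)) (a e) (g e)) (p : List Edge) (j l : V)
    (hp : IsPathFrom src tgt j l p) : ∃ r f, SimInto (K j) (K l) r f := by
  induction p generalizing j with
  | nil =>
    have : j = l := hp
    subst this
    exact ⟨_, _, SimInto.refl _⟩
  | cons e p ih =>
    obtain ⟨h1, h2⟩ := hp
    obtain ⟨r, f, h⟩ := ih _ h2
    rw [← h1]
    exact ⟨_, _, (hs e).comp h⟩

lemma exists_simInto_scale {X V Edge : Type*} [MetricSpace X] {src tgt : Edge → V}
    {a : Edge → ℝ} {g : Edge → X → X} {K : V → Set X}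
    (hs : ∀ e, SimInto (K (src e)) (K (tgt e)) (a e) (g e))
    (hcov : ∀ j, ∀ x ∈ K j, ∃ e, src e = j ∧ ∃ y ∈ K (tgt e), g e y = x)
    {b B : ℝ} (hb : 0 < b) (hb1 : b ≤ 1) (hab : ∀ e, b ≤ a e) (haB : ∀ e, a e ≤ B)
    (k : ℕ) (ρ : ℝ) (hρ : 0 < ρ) (hk : B ^ k ≤ ρ) (j : V) (x : X) (hx : x ∈ K j) :
    ∃ l r f, SimInto (K j) (K l) r f ∧ x ∈ f '' K l ∧ b * min ρ 1 ≤ r ∧ r ≤ ρ := by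
  induction k generalizing ρ j x with
  | zero =>
    rw [pow_zero] at hk
    refine ⟨j, 1, id, SimInto.refl _, ⟨x, hx, rfl⟩, ?_, hk⟩
    rw [min_eq_right hk]; linarith
  | succ k ih =>
    obtain ⟨e, rfl, y, hy, rfl⟩ := hcov j x hx
    have hae : 0 < a e := (hs e).1
    by_cases h : a e ≤ ρ
    · refine ⟨tgt e, a e, g e, hs e, ⟨y, hy, rfl⟩, ?_, h⟩
      calc b * min ρ 1 ≤ b * 1 := by gcongr; exact min_le_right _ _
        _ ≤ a e := by linarith [hab e]
    · rw [not_le] at h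
      have hB : 0 < B := hae.trans_le (haB e)
      have h1 : B ^ k ≤ ρ / a e := by
        rw [le_div_iff₀ hae]
        calc B ^ k * a e ≤ B ^ k * B := by gcongr; exact haB e
          _ = B ^ (k+1) := by ring
          _ ≤ ρ := hk
      obtain ⟨l, r, f, hf, ⟨z, hz, hzy⟩, hr1, hr2⟩ := ih (ρ / a e) (by positivity) h1 _ y hy
      have h2 : ρ / a e ≤ 1 := by rw [div_le_one hae]; exact h.le
      rw [min_eq_left h2] at hr1
      refine ⟨l, _, _, (hs e).comp hf, ⟨z, hz, by simp [hzy]⟩, ?_, ?_⟩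
      · calc b * min ρ 1 ≤ b * ρ := by gcongr; exact min_le_left _ _
          _ = a e * (b * (ρ / a e)) := by field_simp
          _ ≤ a e * r := by gcongr
      · calc a e * r ≤ a e * (ρ / a e) := by gcongr
          _ = ρ := by field_simp

/-- A graph-directed set has equal Hausdorff and upper box dimensions. -/
theorem graphDirected_dimH_eq_upperBoxDim {n : ℕ} (M : ℕ) (hM : 1 ≤ M)
    (Edge : Type) [Fintype Edge] (src tgt : Edge → Fin M)
    (a : Edge → ℝ) (ha : ∀ e, 0 < a e ∧ a e < 1)
    (T : Edge → (EuclideanSpace ℝ (Fin n) ≃ₗᵢ[ℝ] EuclideanSpace ℝ (Fin n)))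
    (bvec : Edge → EuclideanSpace ℝ (Fin n))
    (g : Edge → EuclideanSpace ℝ (Fin n) → EuclideanSpace ℝ (Fin n))
    (hg : ∀ e x, g e x = a e • T e x + bvec e)
    (htrans : ∀ i j : Fin M, ∃ p : List Edge, p ≠ [] ∧ IsPathFrom src tgt i j p)
    (K : Fin M → Set (EuclideanSpace ℝ (Fin n)))
    (hKc : ∀ j, IsCompact (K j)) (hKne : ∀ j, (K j).Nonempty)
    (hinv : ∀ j, K j = ⋃ (e : Edge), ⋃ (_ : src e = j), g e '' K (tgt e))
    (i : Fin M) :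
    dimH (K i) = upperBoxDim (K i) := by
  have hs : ∀ e, SimInto (K (src e)) (K (tgt e)) (a e) (g e) := by
    intro e
    refine ⟨(ha e).1, fun x hx => ?_, fun y z => ?_⟩
    · rw [hinv (src e)]
      exact Set.mem_iUnion₂.mpr ⟨e, rfl, x, hx, rfl⟩
    · rw [hg, hg, dist_add_right, dist_smul₀, Real.norm_eq_abs, abs_of_pos (ha e).1,
        (T e).dist_map]
  have hcov : ∀ j, ∀ x ∈ K j, ∃ e, src e = j ∧ ∃ y ∈ K (tgt e), g e y = x := by
    intro j x hx
    rw [hinv j] at hx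
    obtain ⟨e, he, y, hy, hyx⟩ := Set.mem_iUnion₂.mp hx
    exact ⟨e, he, y, hy, hyx⟩
  have : Nonempty Edge := by
    obtain ⟨x, hx⟩ := hKne i
    obtain ⟨e, -⟩ := hcov i x hx
    exact ⟨e⟩
  have : Nonempty (Fin M) := ⟨i⟩
  obtain ⟨e₀, he₀⟩ := Finite.exists_min a
  obtain ⟨e₁, he₁⟩ := Finite.exists_max a
  have hconn : ∀ l, ∃ r f, SimInto (K l) (K i) r f := by
    intro l
    obtain ⟨p, -, hp⟩ := htrans l i
    exact exists_simInto_of_path hs p l i hp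
  choose q φ hφ using hconn
  obtain ⟨l₀, hl₀⟩ := Finite.exists_min q
  have hq0 : 0 < q l₀ := (hφ l₀).1
  obtain ⟨l₁, hl₁⟩ := Finite.exists_max (fun l => Metric.diam (K l))
  set D : ℝ := max 1 (Metric.diam (K l₁)) with hD
  have hD1 : 1 ≤ D := le_max_left _ _
  have hD0 : 0 < D := by linarith
  have hdiam : ∀ l, ∀ y ∈ K l, ∀ z ∈ K l, dist y z ≤ D := fun l y hy z hz =>
    (Metric.dist_le_diam_of_mem (hKc l).isBounded hy hz).trans ((hl₁ l).trans (le_max_right _ _))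
  have hb := (ha e₀).1
  refine le_antisymm (dimH_le_upperBoxDim _)
    (upperBoxDim_le_dimH_of_copies (c := a e₀ * q l₀ / D) (hKc i) (hKne i) (by positivity) ?_)
  intro r hr hr1 x hx
  have hρ : 0 < r / D := by positivity
  have hρ1 : r / D ≤ 1 := by rw [div_le_one hD0]; linarith
  obtain ⟨k, hk⟩ := exists_pow_lt_of_lt_one hρ (ha e₁).2
  obtain ⟨l, r', f, hf, ⟨z, hz, hzx⟩, h1, h2⟩ := exists_simInto_scale hs hcov hb (ha e₀).2.le
    he₀ he₁ k (r / D) hρ hk.le i x hx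
  rw [min_eq_left hρ1] at h1
  have hF := hf.comp (hφ l)
  refine ⟨_, hF.continuous, hF.2.1, fun y hy => ?_, fun y _ w _ => ?_⟩
  · rw [← hzx, Function.comp_apply, hf.2.2]
    calc r' * dist (φ l y) z ≤ (r / D) * D := by
          gcongr
          exact hdiam l _ ((hφ l).2.1 hy) _ hz
      _ = r := by field_simp
  · rw [hF.2.2]
    calc a e₀ * q l₀ / D * r * dist y w = (a e₀ * (r / D)) * q l₀ * dist y w := by ring
      _ ≤ r' * q l * dist y w := by
          have := hl₀ l
          have hr' := hf.1.le
          gcongr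

end
end
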